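/- arXiv:1904.05963 — 2 statements merged into one kernel-verified Lean document; each statement's English description precedes it below -/
import Mathlib

section
/- Let d,m ∈ ℕ, T,κ ∈ [0,∞), let μ ∈ C¹(ℝ^d,ℝ^d), σ ∈ ℝ^{d×m}, φ ∈ C(ℝ^m,[0,∞)), V ∈ C¹(ℝ^d,[0,∞)), let ‖·‖ be a norm on ℝ^d, assume for all x,h ∈ ℝ^d and z ∈ ℝ^m that ‖μ'(x)h‖ ≤ κ(1+‖x‖^κ)‖h‖, V'(x)μ(x+σz) ≤ φ(z)V(x), and ‖x‖ ≤ V(x), let (Ω,ℱ,ℙ) be a probability space, let W: [0,T]×Ω → ℝ^m be a stochastic process with continuous sample paths, and assume for all c ∈ [0,∞) that E[sup_{t∈[0,T]∩ℚ} exp(c·φ(W(t)))] + E[sup_{t∈[0,T]∩ℚ} ‖σW(t)‖^c] < ∞. Then (i) there exist unique stochastic processes X^x: [0,T]×Ω → ℝ^d, x ∈ ℝ^d, with continuous sample paths satisfying X^x(t,ω) = x + ∫₀^t μ(X^x(s,ω)) ds + σW(t,ω) for all x ∈ ℝ^d, t ∈ [0,T], ω ∈ Ω; (ii) for all R,r ∈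 [0,∞) it holds that sup_{x: ‖x‖≤R} sup_{t∈[0,T]} E[‖X^x(t)‖^r] < ∞; and (iii) for all R,q ∈ [0,∞) there exists c ∈ (0,∞) such that for all h ∈ ℝ^d with 0 < ‖h‖ < 1 it holds that sup_{x: ‖x‖≤R} sup_{t∈[0,T]} E[‖X^{x+h}(t) − X^x(t)‖] ≤ c·|ln(‖h‖)|^{−q}. -/
open MeasureTheory ProbabilityTheory Filter
open scoped ENNReal NNReal

noncomputable section

/-- `N` is a norm on the real vector space `E`. -/
def IsNorm {E : Type*} [AddCommGroup E] [Module ℝ E] (N : E → ℝ) : Prop :=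
  (∀ x, N x = 0 ↔ x = 0) ∧ (∀ (a : ℝ) (x : E), N (a • x) = |a| * N x) ∧
    ∀ x y, N (x + y) ≤ N x + N y

/-- `X` is a family of solution processes of the SDE
`X^x(t) = x + ∫_0^t μ(X^x(s)) ds + σ W(t)` on `[0,T]`: every `X^x` is a
stochastic process with continuous sample paths satisfying the integral
equation for all `t ∈ [0,T]` and all `ω`. -/
def IsSolution (d m : ℕ) (T : ℝ) (μ : (Fin d → ℝ) → (Fin d → ℝ))
    (σ : Matrix (Fin d) (Fin m) ℝ) {Ω : Type*} [MeasurableSpace Ω]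
    (W : ℝ → Ω → (Fin m → ℝ)) (X : (Fin d → ℝ) → ℝ → Ω → (Fin d → ℝ)) : Prop :=
  ∀ x : Fin d → ℝ,
    (∀ t ∈ Set.Icc (0 : ℝ) T, Measurable (fun ω => X x t ω)) ∧
    (∀ ω, ContinuousOn (fun t => X x t ω) (Set.Icc (0 : ℝ) T)) ∧
    (∀ t ∈ Set.Icc (0 : ℝ) T, ∀ ω, X x t ω =
      x + (∫ s in (0 : ℝ)..t, μ (X x s ω)) + σ.mulVec (W t ω))

/-- the rational points of the interval `[0,T]`. -/
def ratIcc (T : ℝ) : Set ℝ := Set.Icc 0 T ∩ Set.range ((↑) : ℚ → ℝ)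

/-- the points of `ℚ^d` whose `N`-norm is at most `R`. -/
def ratBall (d : ℕ) (N : (Fin d → ℝ) → ℝ) (R : ℝ) : Set (Fin d → ℝ) :=
  {x | (∀ i, ∃ q : ℚ, (q : ℝ) = x i) ∧ N x ≤ R}

section Norm

variable {d : ℕ} {N : (Fin d → ℝ) → ℝ}

lemma IsNorm.map_zero (hN : IsNorm N) : N 0 = 0 := (hN.1 0).2 rfl

lemma IsNorm.map_neg (hN : IsNorm N) (x : Fin d → ℝ) : N (-x) = N x := by
  simpa using hN.2.1 (-1) x

lemma IsNorm.nonneg (hN : IsNorm N) (x : Fin d → ℝ) : 0 ≤ N x := by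
  have h := hN.2.2 x (-x)
  rw [add_neg_cancel, hN.map_zero, hN.map_neg] at h
  linarith

lemma IsNorm.sub_le (hN : IsNorm N) (x y : Fin d → ℝ) : N (x - y) ≤ N x + N y := by
  have h := hN.2.2 x (-y)
  rwa [hN.map_neg, ← sub_eq_add_neg] at h

lemma IsNorm.convexOn (hN : IsNorm N) : ConvexOn ℝ Set.univ N := by
  refine ⟨convex_univ, fun x _ y _ a b ha hb _ => (hN.2.2 _ _).trans ?_⟩
  rw [hN.2.1, hN.2.1, abs_of_nonneg ha, abs_of_nonneg hb, smul_eq_mul, smul_eq_mul]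

lemma IsNorm.continuous (hN : IsNorm N) : Continuous N :=
  continuousOn_univ.1 (hN.convexOn.continuousOn isOpen_univ)

/-- Every norm on `ℝ^d` dominates a multiple of the maximum norm. -/
lemma IsNorm.exists_norm_le (hN : IsNorm N) : ∃ C, 0 ≤ C ∧ ∀ x, ‖x‖ ≤ C * N x := by
  rcases (Metric.sphere (0 : Fin d → ℝ) 1).eq_empty_or_nonempty with h | h
  · refine ⟨0, le_rfl, fun x => ?_⟩
    by_contra! hx
    rw [zero_mul] at hx
    have : ‖x‖⁻¹ • x ∈ Metric.sphere (0 : Fin d → ℝ) 1 := by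
      simp [norm_smul, hx.ne']
    simp [h] at this
  · obtain ⟨z, hz, hmin⟩ := (isCompact_sphere (0 : Fin d → ℝ) 1).exists_isMinOn h
      hN.continuous.continuousOn
    have hz0 : z ≠ 0 := by
      rintro rfl
      simp at hz
    have hpos : 0 < N z := lt_of_le_of_ne (hN.nonneg z) fun h => hz0 ((hN.1 z).1 h.symm)
    refine ⟨(N z)⁻¹, by positivity, fun x => ?_⟩
    rcases eq_or_ne x 0 with rfl | hx
    · simp [hN.map_zero]
    have hx' : 0 < ‖x‖ := norm_pos_iff.2 hx
    have hm : N z ≤ N (‖x‖⁻¹ • x) := hmin (by simp [norm_smul, hx'.ne'])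
    rw [hN.2.1, abs_of_pos (by positivity)] at hm
    rw [inv_mul_eq_div, le_div_iff₀ hpos]
    calc ‖x‖ * N z ≤ ‖x‖ * (‖x‖⁻¹ * N x) := by gcongr
      _ = N x := by field_simp

lemma IsNorm.isCompact_le (hN : IsNorm N) (R : ℝ) : IsCompact {x | N x ≤ R} := by
  obtain ⟨C, hC, h⟩ := hN.exists_norm_le
  refine (isCompact_closedBall (0 : Fin d → ℝ) (C * R)).of_isClosed_subset
    (isClosed_le hN.continuous continuous_const) fun x hx => ?_
  rw [mem_closedBall_zero_iff]
  exact (h x).trans (mul_le_mul_of_nonneg_left hx hC)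

/-- Grönwall's inequality for an arbitrary norm. -/
lemma IsNorm.le_gronwallBound (hN : IsNorm N) {D D' : ℝ → Fin d → ℝ} {a b δ K ε : ℝ}
    (hD : ∀ t ∈ Set.Icc a b, HasDerivWithinAt D (D' t) (Set.Icc a b) t)
    (ha : N (D a) ≤ δ) (hbound : ∀ t ∈ Set.Icc a b, N (D' t) ≤ K * N (D t) + ε) :
    ∀ t ∈ Set.Icc a b, N (D t) ≤ gronwallBound δ K ε (t - a) := by
  refine le_gronwallBound_of_liminf_deriv_right_le (f' := fun t => N (D' t)) ?_ ?_ ha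
    fun t ht => hbound t (Set.Ico_subset_Icc_self ht)
  · exact hN.continuous.comp_continuousOn fun t ht => (hD t ht).continuousWithinAt
  · intro t ht r hr
    have hd : HasDerivWithinAt D (D' t) (Set.Ioi t) t :=
      ((hD t (Set.Ico_subset_Icc_self ht)).mono_of_mem_nhdsWithin
        (Icc_mem_nhdsGE_of_mem ht)).Ioi_of_Ici
    rw [hasDerivWithinAt_iff_tendsto_slope' Set.self_notMem_Ioi] at hd
    have hev := ((hN.continuous.tendsto _).comp hd).eventually_lt_const hr
    refine (hev.and self_mem_nhdsWithin).frequently.mono ?_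
    rintro z ⟨hz, htz⟩
    refine lt_of_le_of_lt ?_ hz
    have hzt : 0 < z - t := sub_pos.2 htz
    rw [Function.comp_apply, slope_def_module, hN.2.1, abs_of_pos (inv_pos.2 hzt)]
    gcongr
    have := hN.2.2 (D z - D t) (D t)
    rw [sub_add_cancel] at this
    linarith

/-- The mean value inequality for an arbitrary norm. -/
lemma IsNorm.sub_le_of_fderiv_le (hN : IsNorm N) {f : (Fin d → ℝ) → Fin d → ℝ}
    (hf : Differentiable ℝ f) {s : Set (Fin d → ℝ)} (hs : Convex ℝ s) {C : ℝ}
    (hC : ∀ x ∈ s, ∀ h, N (fderiv ℝ f x h) ≤ C * N h) {x y : Fin d → ℝ} (hx : x ∈ s)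
    (hy : y ∈ s) : N (f y - f x) ≤ C * N (y - x) := by
  have hderiv : ∀ t ∈ Set.Icc (0 : ℝ) 1,
      HasDerivWithinAt (fun t : ℝ => f (x + t • (y - x)) - f x)
        (fderiv ℝ f (x + t • (y - x)) (y - x)) (Set.Icc 0 1) t := by
    intro t _
    have h1 : HasDerivAt (fun t : ℝ => x + t • (y - x)) (y - x) t := by
      simpa using ((hasDerivAt_id t).smul_const (y - x)).const_add x
    exact (((hf _).hasFDerivAt.comp_hasDerivAt t h1).sub_const (f x)).hasDerivWithinAt
  have h := hN.le_gronwallBound (δ := 0) (K := 0) (ε := C * N (y - x)) hderiv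
    (by simp [hN.map_zero]) (fun t ht => by
      rw [zero_mul, zero_add]
      exact hC _ (hs.add_smul_sub_mem hx hy ht) _) 1 (Set.right_mem_Icc.2 zero_le_one)
  simpa [gronwallBound_K0] using h

end Norm

section ODE

variable {E : Type*} [NormedAddCommGroup E] [NormedSpace ℝ E]

/-- `y` solves the initial value problem `y' = F (y, w)`, `y 0 = x` on `[0,T]`. -/
def SolvesIVP (F : E × E → E) (T : ℝ) (w : ℝ → E) (x : E) (y : ℝ → E) : Prop :=
  y 0 = x ∧ ∀ t ∈ Set.Icc (0 : ℝ) T, HasDerivWithinAt y (F (y t, w t)) (Set.Icc 0 T) t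

variable {F : E × E → E} {T : ℝ} {w : ℝ → E} {x : E} {y : ℝ → E}

lemma SolvesIVP.continuousOn (h : SolvesIVP F T w x y) : ContinuousOn y (Set.Icc 0 T) :=
  fun t ht => (h.2 t ht).continuousWithinAt

lemma SolvesIVP.eq_integral [CompleteSpace E] (hF : Continuous F) (hw : Continuous w)
    (h : SolvesIVP F T w x y) {t : ℝ} (ht : t ∈ Set.Icc (0 : ℝ) T) :
    y t = x + ∫ s in (0 : ℝ)..t, F (y s, w s) := by
  have hsub : Set.Icc 0 t ⊆ Set.Icc 0 T := Set.Icc_subset_Icc_right ht.2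
  rw [intervalIntegral.integral_eq_sub_of_hasDeriv_right_of_le ht.1 (h.continuousOn.mono hsub)
    (f' := fun s => F (y s, w s)) ?_ ?_, h.1, add_sub_cancel]
  · intro s hs
    exact ((h.2 s (hsub (Set.Ioo_subset_Icc_self hs))).mono_of_mem_nhdsWithin
      (Icc_mem_nhdsGE_of_mem ⟨hs.1.le, hs.2.trans_le ht.2⟩)).Ioi_of_Ici
  · refine ContinuousOn.intervalIntegrable_of_Icc ht.1 ?_
    exact hF.comp_continuousOn ((h.continuousOn.mono hsub).prodMk hw.continuousOn)

lemma solvesIVP_of_eq_integral [CompleteSpace E] (hT : 0 ≤ T) (hF : Continuous F)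
    (hw : Continuous w) (hy : ContinuousOn y (Set.Icc 0 T))
    (h : ∀ t ∈ Set.Icc (0 : ℝ) T, y t = x + ∫ s in (0 : ℝ)..t, F (y s, w s)) :
    SolvesIVP F T w x y := by
  refine ⟨by simpa using h 0 (Set.left_mem_Icc.2 hT), fun t ht => ?_⟩
  have hc : Continuous (Set.IccExtend hT ((Set.Icc 0 T).domRestrict y)) :=
    (continuousOn_iff_continuous_domRestrict.1 hy).Icc_extend'
  have heq : ∀ s ∈ Set.Icc (0 : ℝ) T, Set.IccExtend hT ((Set.Icc 0 T).domRestrict y) s = y s :=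
    fun s hs => by rw [Set.IccExtend_of_mem hT _ hs]; rfl
  have hg : Continuous fun s => F (Set.IccExtend hT ((Set.Icc 0 T).domRestrict y) s, w s) :=
    hF.comp (hc.prodMk hw)
  have hd := ((hg.integral_hasStrictDerivAt 0 t).hasDerivAt.const_add x).hasDerivWithinAt
    (s := Set.Icc 0 T)
  simp only [heq t ht] at hd
  have key : ∀ s ∈ Set.Icc (0 : ℝ) T, y s =
      x + ∫ u in (0 : ℝ)..s, F (Set.IccExtend hT ((Set.Icc 0 T).domRestrict y) u, w u) := by
    intro s hs
    rw [h s hs]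
    congr 1
    refine intervalIntegral.integral_congr fun u hu => ?_
    rw [Set.uIcc_of_le hs.1] at hu
    simp only [heq u ⟨hu.1, hu.2.trans hs.2⟩]
  exact hd.congr key (key t ht)

/-- Initial value problems with a bounded, globally Lipschitz vector field are solvable. -/
lemma exists_solvesIVP [CompleteSpace E] {L : ℝ≥0} (hL : LipschitzWith L F) {C : ℝ}
    (hC : ∀ p, ‖F p‖ ≤ C) (hT : 0 ≤ T) (hw : Continuous w) (x : E) :
    ∃ y, SolvesIVP F T w x y := by
  have hC0 : 0 ≤ C := (norm_nonneg _).trans (hC 0)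
  have hP : IsPicardLindelof (fun t z => F (z, w t)) (⟨0, Set.left_mem_Icc.2 hT⟩ : Set.Icc 0 T)
      x (⟨C * T, by positivity⟩ : ℝ≥0) 0 ⟨C, hC0⟩ L :=
    { lipschitzOnWith := fun t _ => by
        have := hL.comp (LipschitzWith.prodMk_right (α := E) (w t))
        rw [mul_one] at this
        exact this.lipschitzOnWith
      continuousOn := fun z _ =>
        (hL.continuous.comp (continuous_const.prodMk hw)).continuousOn
      norm_le := fun t _ z _ => hC _
      mul_max_le := by
        simp only [sub_zero, sub_self, max_eq_left hT, NNReal.coe_zero]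
        exact le_rfl }
  obtain ⟨y, hy⟩ := hP.exists_eq_forall_mem_Icc_hasDerivWithinAt₀
  exact ⟨y, hy⟩

end ODE

section PicardIteration

variable {d : ℕ} {Ω : Type*}

/-- The Picard iterates of the random initial value problem `y' = F (y, w)`, `y 0 = x`. -/
def picardIterate (F : (Fin d → ℝ) × (Fin d → ℝ) → Fin d → ℝ) (w : ℝ → Ω → Fin d → ℝ)
    (x : Fin d → ℝ) : ℕ → ℝ → Ω → Fin d → ℝ
  | 0, _, _ => x
  | k + 1, t, ω => x + ∫ s in (0 : ℝ)..t, F (picardIterate F w x k s ω, w s ω)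

variable {F : (Fin d → ℝ) × (Fin d → ℝ) → Fin d → ℝ} {w : ℝ → Ω → Fin d → ℝ}

lemma continuous_picardIterate (hF : Continuous F) (hw : ∀ ω, Continuous fun t => w t ω)
    (x : Fin d → ℝ) (k : ℕ) (ω : Ω) : Continuous fun t => picardIterate F w x k t ω := by
  induction k with
  | zero => exact continuous_const
  | succ k ih =>
    refine continuous_const.add (intervalIntegral.continuous_primitive (fun a b => ?_) 0)
    exact (hF.comp (ih.prodMk (hw ω))).intervalIntegrable a b

lemma measurable_picardIterate [MeasurableSpace Ω] (hF : Continuous F)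
    (hw : ∀ ω, Continuous fun t => w t ω) (hwm : ∀ t, Measurable (w t)) (x : Fin d → ℝ) (k : ℕ)
    (t : ℝ) :
    Measurable (picardIterate F w x k t) := by
  induction k generalizing t with
  | zero => exact measurable_const
  | succ k ih =>
    have hm : Measurable (Function.uncurry fun (s : ℝ) (ω : Ω) =>
        F (picardIterate F w x k s ω, w s ω)) :=
      measurable_uncurry_of_continuous_of_measurable
        (fun ω => hF.comp ((continuous_picardIterate hF hw x k ω).prodMk (hw ω)))
        fun s => hF.measurable.comp ((ih s).prodMk (hwm s))
    have hi : ∀ S : Set ℝ, Measurable fun ω => ∫ s in S, F (picardIterate F w x k s ω, w s ω) :=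
      fun S => (hm.stronglyMeasurable.integral_prod_left (μ := volume.restrict S)).measurable
    exact measurable_const.add ((hi _).sub (hi _))

lemma norm_picardIterate_sub_le {L : ℝ≥0} (hL : LipschitzWith L F) {T : ℝ}
    (hw : ∀ ω, Continuous fun t => w t ω) {x : Fin d → ℝ} {ω : Ω} {y : ℝ → Fin d → ℝ}
    (hy : SolvesIVP F T (fun t => w t ω) x y) {D : ℝ} (hD : ∀ t ∈ Set.Icc 0 T, ‖x - y t‖ ≤ D)
    (k : ℕ) : ∀ t ∈ Set.Icc (0 : ℝ) T,
      ‖picardIterate F w x k t ω - y t‖ ≤ D * ((L * t) ^ k / k.factorial) := by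
  induction k with
  | zero => simpa [picardIterate] using hD
  | succ k ih =>
    intro t ht
    have hsub : Set.Icc 0 t ⊆ Set.Icc 0 T := Set.Icc_subset_Icc_right ht.2
    rw [hy.eq_integral hL.continuous (hw ω) ht, picardIterate, add_sub_add_left_eq_sub,
      ← intervalIntegral.integral_sub]
    · have hle : ‖∫ s in (0 : ℝ)..t, (F (picardIterate F w x k s ω, w s ω) - F (y s, w s ω))‖ ≤
          ∫ s in (0 : ℝ)..t, L * (D * ((L * s) ^ k / k.factorial)) := by
        refine intervalIntegral.norm_integral_le_of_norm_le ht.1 (ae_of_all _ fun s hs => ?_) ?_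
        · have h1 := hL.dist_le_mul (picardIterate F w x k s ω, w s ω) (y s, w s ω)
          rw [Prod.dist_eq, dist_self, max_eq_left dist_nonneg, dist_eq_norm, dist_eq_norm] at h1
          exact h1.trans (mul_le_mul_of_nonneg_left
            (ih s (hsub (Set.Ioc_subset_Icc_self hs))) L.2)
        · exact Continuous.intervalIntegrable (by fun_prop) _ _
      refine hle.trans_eq ?_
      have : ∀ s : ℝ, L * (D * ((L * s) ^ k / k.factorial)) =
          (L * D * L ^ k / k.factorial) * s ^ k := fun s => by rw [mul_pow]; ring
      simp_rw [this]
      rw [intervalIntegral.integral_const_mul, integral_pow, Nat.factorial_succ]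
      push_cast
      field_simp
      ring
    · exact (hL.continuous.comp ((continuous_picardIterate hL.continuous hw x k ω).prodMk
        (hw ω))).intervalIntegrable _ _
    · exact ContinuousOn.intervalIntegrable_of_Icc ht.1 (hL.continuous.comp_continuousOn
        ((hy.continuousOn.mono hsub).prodMk (hw ω).continuousOn))

/-- Solutions of random initial value problems are measurable in the random parameter. -/
lemma measurable_of_solvesIVP [MeasurableSpace Ω] {L : ℝ≥0} (hL : LipschitzWith L F) {T : ℝ}
    (hw : ∀ ω, Continuous fun t => w t ω) (hwm : ∀ t, Measurable (w t)) {x : Fin d → ℝ}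
    {y : ℝ → Ω → Fin d → ℝ} (hy : ∀ ω, SolvesIVP F T (fun t => w t ω) x fun t => y t ω)
    {t : ℝ} (ht : t ∈ Set.Icc 0 T) : Measurable (y t) := by
  refine measurable_of_tendsto_metrizable
    (fun k => measurable_picardIterate hL.continuous hw hwm x k t) (tendsto_pi_nhds.2 fun ω => ?_)
  obtain ⟨D, hD⟩ := isCompact_Icc.exists_bound_of_continuousOn
    (continuousOn_const.sub (hy ω).continuousOn : ContinuousOn (fun t => x - y t ω) (Set.Icc 0 T))
  rw [tendsto_iff_norm_sub_tendsto_zero]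
  refine squeeze_zero (fun _ => norm_nonneg _)
    (fun k => norm_picardIterate_sub_le hL hw (hy ω) hD k t ht) ?_
  simpa using (FloorSemiring.tendsto_pow_div_factorial_atTop (L * t : ℝ)).const_mul D

end PicardIteration

section Lyapunov

variable {d : ℕ} {μ : (Fin d → ℝ) → Fin d → ℝ} {V N : (Fin d → ℝ) → ℝ} {T κ : ℝ}

lemma lyapunov_le_mul_exp (hV : ContDiff ℝ 1 V) (hV0 : ∀ x, 0 ≤ V x) {Φ : ℝ} (hΦ : 0 ≤ Φ)
    {G : (Fin d → ℝ) × (Fin d → ℝ) → Fin d → ℝ}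
    (hG : ∀ p, ∃ a ∈ Set.Icc (0 : ℝ) 1, G p = a • μ (p.1 + p.2)) {w y : ℝ → Fin d → ℝ}
    {x : Fin d → ℝ} (hy : SolvesIVP G T w x y)
    (hLyap : ∀ t ∈ Set.Icc 0 T, ∀ z, fderiv ℝ V z (μ (z + w t)) ≤ Φ * V z) {t : ℝ}
    (ht : t ∈ Set.Icc 0 T) : V (y t) ≤ V x * Real.exp (Φ * T) := by
  have hd : ∀ s ∈ Set.Icc (0 : ℝ) T, HasDerivWithinAt (fun s => V (y s))
      (fderiv ℝ V (y s) (G (y s, w s))) (Set.Icc 0 T) s := fun s hs =>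
    ((hV.differentiable one_ne_zero) _).hasFDerivAt.comp_hasDerivWithinAt s (hy.2 s hs)
  have h := le_gronwallBound_of_liminf_deriv_right_le (f := fun s => V (y s))
    (f' := fun s => fderiv ℝ V (y s) (G (y s, w s))) (δ := V x) (K := Φ) (ε := 0)
    (fun s hs => (hd s hs).continuousWithinAt) (fun s hs r hr => ?_) (by rw [hy.1])
    (fun s hs => ?_) t ht
  · rw [gronwallBound_ε0, sub_zero] at h
    refine h.trans (mul_le_mul_of_nonneg_left (Real.exp_le_exp.2 ?_) (hV0 x))
    exact mul_le_mul_of_nonneg_left ht.2 hΦ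
  · have := ((hd s (Set.Ico_subset_Icc_self hs)).mono_of_mem_nhdsWithin
      (Icc_mem_nhdsGE_of_mem hs)).liminf_right_slope_le hr
    simpa only [slope_def_module, smul_eq_mul] using this
  · obtain ⟨a, ha, hGa⟩ := hG (y s, w s)
    simp only [hGa, map_smul, smul_eq_mul, add_zero]
    have h1 := hLyap s (Set.Ico_subset_Icc_self hs) (y s)
    have h2 : 0 ≤ Φ * V (y s) := mul_nonneg hΦ (hV0 _)
    nlinarith [ha.1, ha.2, mul_le_mul_of_nonneg_left h1 ha.1]

/-- Two solutions staying in a bounded set differ at most exponentially. -/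
lemma IsNorm.sub_le_of_solvesIVP (hN : IsNorm N) (hμ : ContDiff ℝ 1 μ) (hκ : 0 ≤ κ)
    (hgrow : ∀ x h, N (fderiv ℝ μ x h) ≤ κ * (1 + N x ^ κ) * N h) {M : ℝ} (hM : 0 ≤ M)
    {w y₁ y₂ : ℝ → Fin d → ℝ} {x₁ x₂ : Fin d → ℝ}
    (h₁ : SolvesIVP (fun p => μ (p.1 + p.2)) T w x₁ y₁)
    (h₂ : SolvesIVP (fun p => μ (p.1 + p.2)) T w x₂ y₂)
    (hM₁ : ∀ t ∈ Set.Icc 0 T, N (y₁ t + w t) ≤ M) (hM₂ : ∀ t ∈ Set.Icc 0 T, N (y₂ t + w t) ≤ M)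
    {t : ℝ} (ht : t ∈ Set.Icc 0 T) :
    N (y₁ t - y₂ t) ≤ N (x₁ - x₂) * Real.exp (κ * (1 + M ^ κ) * T) := by
  have hcvx : Convex ℝ {z | N z ≤ M} := by simpa using hN.convexOn.convex_le M
  have h := hN.le_gronwallBound (D := fun s => y₁ s - y₂ s) (δ := N (x₁ - x₂))
    (K := κ * (1 + M ^ κ)) (ε := 0) (fun s hs => (h₁.2 s hs).sub (h₂.2 s hs))
    (by rw [h₁.1, h₂.1]) (fun s hs => ?_) t ht
  · rw [gronwallBound_ε0, sub_zero] at h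
    refine h.trans (mul_le_mul_of_nonneg_left (Real.exp_le_exp.2 ?_) (hN.nonneg _))
    exact mul_le_mul_of_nonneg_left ht.2 (by positivity)
  · rw [add_zero]
    have := hN.sub_le_of_fderiv_le (hμ.differentiable one_ne_zero) hcvx
      (C := κ * (1 + M ^ κ)) (fun z hz h => (hgrow z h).trans ?_) (hM₂ s hs) (hM₁ s hs)
    · rwa [add_sub_add_right_eq_sub] at this
    · have hz' : N z ≤ M := hz
      have := hN.nonneg z
      have := hN.nonneg h
      gcongr

lemma SolvesIVP.unique (hN : IsNorm N) (hμ : ContDiff ℝ 1 μ) (hκ : 0 ≤ κ)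
    (hgrow : ∀ x h, N (fderiv ℝ μ x h) ≤ κ * (1 + N x ^ κ) * N h)
    {w y₁ y₂ : ℝ → Fin d → ℝ} {x : Fin d → ℝ} (hw : Continuous w)
    (h₁ : SolvesIVP (fun p => μ (p.1 + p.2)) T w x y₁)
    (h₂ : SolvesIVP (fun p => μ (p.1 + p.2)) T w x y₂) {t : ℝ} (ht : t ∈ Set.Icc 0 T) :
    y₁ t = y₂ t := by
  have hb : ∀ {y}, SolvesIVP (fun p => μ (p.1 + p.2)) T w x y →
      ∃ M, ∀ t ∈ Set.Icc 0 T, N (y t + w t) ≤ M := fun hy => by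
    obtain ⟨M, hM⟩ := isCompact_Icc.exists_bound_of_continuousOn
      (hN.continuous.comp_continuousOn (hy.continuousOn.add hw.continuousOn))
    exact ⟨M, fun t ht => (le_abs_self _).trans (hM t ht)⟩
  obtain ⟨M₁, hM₁⟩ := hb h₁
  obtain ⟨M₂, hM₂⟩ := hb h₂
  have h := hN.sub_le_of_solvesIVP hμ hκ hgrow (M := max M₁ M₂)
    ((hN.nonneg _).trans ((hM₁ t ht).trans (le_max_left _ _))) h₁ h₂
    (fun s hs => (hM₁ s hs).trans (le_max_left _ _))
    (fun s hs => (hM₂ s hs).trans (le_max_right _ _)) ht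
  rw [sub_self, hN.map_zero, zero_mul] at h
  exact sub_eq_zero.1 ((hN.1 _).1 (le_antisymm h (hN.nonneg _)))

lemma exists_lipschitz_cutoff (hμ : ContDiff ℝ 1 μ) (n : ℕ) :
    ∃ G : (Fin d → ℝ) × (Fin d → ℝ) → Fin d → ℝ, (∃ L, LipschitzWith L G) ∧
      (∃ C, ∀ p, ‖G p‖ ≤ C) ∧ (∀ p, ‖p‖ ≤ n → G p = μ (p.1 + p.2)) ∧
      ∀ p, ∃ a ∈ Set.Icc (0 : ℝ) 1, G p = a • μ (p.1 + p.2) := by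
  let χ : ContDiffBump (0 : (Fin d → ℝ) × (Fin d → ℝ)) :=
    ⟨n + 1, n + 2, by positivity, by linarith⟩
  have hsmooth : ContDiff ℝ 1 fun p => χ p • μ (p.1 + p.2) :=
    χ.contDiff.smul (hμ.comp (contDiff_fst.add contDiff_snd))
  have hsupp : HasCompactSupport fun p => χ p • μ (p.1 + p.2) := χ.hasCompactSupport.smul_right
  refine ⟨fun p => χ p • μ (p.1 + p.2),
    hsmooth.lipschitzWith_of_hasCompactSupport hsupp one_ne_zero,
    hsupp.exists_bound_of_continuous hsmooth.continuous, fun p hp => ?_,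
    fun p => ⟨χ p, ⟨χ.nonneg, χ.le_one⟩, rfl⟩⟩
  have : χ p = 1 := χ.one_of_mem_closedBall <| by
    rw [mem_closedBall_zero_iff]
    exact hp.trans (lt_add_one _).le
  simp only [this, one_smul]

lemma exists_measurable_solvesIVP (hT : 0 ≤ T) (hN : IsNorm N) (hμ : ContDiff ℝ 1 μ)
    (hκ : 0 ≤ κ) (hgrow : ∀ x h, N (fderiv ℝ μ x h) ≤ κ * (1 + N x ^ κ) * N h)
    (hV : ContDiff ℝ 1 V) (hV0 : ∀ x, 0 ≤ V x) (hNV : ∀ x, N x ≤ V x)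
    {Ω : Type*} [MeasurableSpace Ω] {w : ℝ → Ω → Fin d → ℝ}
    (hw : ∀ ω, Continuous fun t => w t ω) (hwm : ∀ t, Measurable (w t)) {Φ : Ω → ℝ}
    (hΦ : ∀ ω, 0 ≤ Φ ω)
    (hLyap : ∀ ω, ∀ t ∈ Set.Icc 0 T, ∀ z, fderiv ℝ V z (μ (z + w t ω)) ≤ Φ ω * V z)
    (x : Fin d → ℝ) :
    ∃ y : ℝ → Ω → Fin d → ℝ,
      (∀ ω, SolvesIVP (fun p => μ (p.1 + p.2)) T (fun t => w t ω) x fun t => y t ω) ∧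
      ∀ t ∈ Set.Icc 0 T, Measurable (y t) := by
  choose G hL hC hGn hGa using fun n => exists_lipschitz_cutoff hμ n
  choose L hL using hL
  choose C hC using hC
  choose z hz using fun n ω => exists_solvesIVP (hL n) (hC n) hT (hw ω) x
  have hbound : ∀ ω, ∃ k : ℕ, ∀ n, ∀ t ∈ Set.Icc 0 T, ‖(z n ω t, w t ω)‖ ≤ k := by
    intro ω
    obtain ⟨c, hc0, hc⟩ := hN.exists_norm_le
    obtain ⟨B, hB⟩ := isCompact_Icc.exists_bound_of_continuousOn
      ((hw ω).continuousOn (s := Set.Icc 0 T))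
    obtain ⟨k, hk⟩ := exists_nat_ge (max (c * (V x * Real.exp (Φ ω * T))) B)
    refine ⟨k, fun n t ht => le_trans ?_ hk⟩
    refine max_le_max ((hc _).trans (mul_le_mul_of_nonneg_left ((hNV _).trans ?_) hc0)) (hB t ht)
    exact lyapunov_le_mul_exp hV hV0 (hΦ ω) (hGa n) (hz n ω) (hLyap ω) ht
  choose k hk using hbound
  have hsol : ∀ ω n, k ω ≤ n →
      SolvesIVP (fun p => μ (p.1 + p.2)) T (fun t => w t ω) x (z n ω) := by
    refine fun ω n hn => ⟨(hz n ω).1, fun t ht => ?_⟩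
    have := (hz n ω).2 t ht
    rwa [hGn n _ ((hk ω n t ht).trans (by exact_mod_cast hn))] at this
  refine ⟨fun t ω => z (k ω) ω t, fun ω => hsol ω _ le_rfl, fun t ht => ?_⟩
  refine measurable_of_tendsto_metrizable (f := fun n ω => z n ω t)
    (fun n => measurable_of_solvesIVP (hL n) hw hwm (y := fun t ω => z n ω t) (hz n) ht)
    (tendsto_pi_nhds.2 fun ω => tendsto_const_nhds.congr' ?_)
  filter_upwards [eventually_ge_atTop (k ω)] with n hn
  exact (hsol ω _ le_rfl).unique hN hμ hκ hgrow (hw ω) (hsol ω n hn) ht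

end Lyapunov

section Estimates

lemma rpow_le_mul_exp_half {q l : ℝ} (hq : 0 ≤ q) (hl : 0 ≤ l) :
    l ^ q ≤ (2 * (q + 1)) ^ q * Real.exp (l / 2) := by
  have h1 : l ≤ 2 * (q + 1) * Real.exp (l / (2 * (q + 1))) := by
    have := Real.add_one_le_exp (l / (2 * (q + 1)))
    calc l = 2 * (q + 1) * (l / (2 * (q + 1))) := by field_simp
      _ ≤ _ := by gcongr; linarith
  calc l ^ q ≤ (2 * (q + 1) * Real.exp (l / (2 * (q + 1)))) ^ q := by gcongr
    _ = (2 * (q + 1)) ^ q * Real.exp (l / (2 * (q + 1)) * q) := by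
        rw [Real.mul_rpow (by positivity) (by positivity), ← Real.exp_mul]
    _ ≤ _ := by
        gcongr
        rw [div_mul_eq_mul_div, div_le_div_iff₀ (by positivity) (by positivity)]
        nlinarith

/-- A quantity bounded both by `2 * M` and by `h * exp A` is of logarithmic order in `h`. -/
lemma le_mul_abs_log_rpow {h A M D q : ℝ} (hh0 : 0 < h) (hh1 : h < 1) (hA : 0 ≤ A) (hM : 0 ≤ M)
    (hq : 0 ≤ q) (hD₁ : D ≤ h * Real.exp A) (hD₂ : D ≤ 2 * M) :
    D ≤ (2 * M * (2 * A) ^ q + (2 * (q + 1)) ^ q) * |Real.log h| ^ (-q) := by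
  obtain ⟨l, hl⟩ : ∃ l, l = |Real.log h| := ⟨_, rfl⟩
  have hneg := Real.log_neg hh0 hh1
  have hlpos : 0 < l := hl ▸ abs_pos.2 hneg.ne
  have hexp : h = Real.exp (-l) := by
    rw [hl, abs_of_neg hneg, neg_neg, Real.exp_log hh0]
  rw [← hl, Real.rpow_neg hlpos.le, ← div_eq_mul_inv, le_div_iff₀ (by positivity)]
  rcases le_or_gt A (l / 2) with hAl | hAl
  · have h1 : D ≤ Real.exp (-(l / 2)) := by
      refine hD₁.trans ?_
      rw [hexp, ← Real.exp_add, Real.exp_le_exp]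
      linarith
    calc D * l ^ q ≤ Real.exp (-(l / 2)) * ((2 * (q + 1)) ^ q * Real.exp (l / 2)) := by
          gcongr
          exact rpow_le_mul_exp_half hq hlpos.le
      _ = (2 * (q + 1)) ^ q := by
          rw [mul_left_comm, ← Real.exp_add, neg_add_cancel, Real.exp_zero, mul_one]
      _ ≤ _ := le_add_of_nonneg_left (by positivity)
  · calc D * l ^ q ≤ 2 * M * (2 * A) ^ q := by
          gcongr
          linarith
      _ ≤ _ := le_add_of_nonneg_right (by positivity)

lemma two_mul_rpow_add_le {κ T M q c : ℝ} (hκ : 0 ≤ κ) (hT : 0 ≤ T) (hM : 0 ≤ M) (hq : 0 ≤ q)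
    (hc : 0 ≤ c) :
    2 * M * (2 * (κ * (1 + M ^ κ) * T)) ^ q + c ≤
      (2 * (4 * (κ * T)) ^ q + c) * (1 + M) ^ (1 + κ * q) := by
  have h1 : (2 * (κ * (1 + M ^ κ) * T)) ^ q ≤ (4 * (κ * T)) ^ q * (1 + M) ^ (κ * q) := by
    rw [Real.rpow_mul (by positivity), ← Real.mul_rpow (by positivity) (by positivity)]
    refine Real.rpow_le_rpow (by positivity) ?_ hq
    have h2 : (1 : ℝ) ≤ (1 + M) ^ κ := Real.one_le_rpow (by linarith) hκ
    have h3 : M ^ κ ≤ (1 + M) ^ κ := Real.rpow_le_rpow hM (by linarith) hκ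
    nlinarith [mul_nonneg hκ hT]
  have h4 : (1 : ℝ) ≤ (1 + M) ^ (1 + κ * q) := Real.one_le_rpow (by linarith) (by positivity)
  rw [add_mul]
  refine add_le_add ?_ (le_mul_of_one_le_right hc h4)
  calc 2 * M * (2 * (κ * (1 + M ^ κ) * T)) ^ q
      ≤ 2 * (1 + M) * ((4 * (κ * T)) ^ q * (1 + M) ^ (κ * q)) := by
        gcongr
        linarith
    _ = 2 * (4 * (κ * T)) ^ q * (1 + M) ^ (1 + κ * q) := by
        rw [Real.rpow_add (by positivity), Real.rpow_one]
        ring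

lemma one_add_add_rpow_le {a b p : ℝ} (ha : 0 ≤ a) (hb : 0 ≤ b) (hp : 0 ≤ p) :
    (1 + (a + b)) ^ p ≤ 3 ^ p * (1 + (a ^ p + b ^ p)) := by
  have hap : 0 ≤ a ^ p := by positivity
  have hbp : 0 ≤ b ^ p := by positivity
  have key : ∀ {m : ℝ}, 0 ≤ m → 1 ≤ m → a ≤ m → b ≤ m → m ^ p ≤ 1 + (a ^ p + b ^ p) →
      (1 + (a + b)) ^ p ≤ 3 ^ p * (1 + (a ^ p + b ^ p)) := fun {m} h0 h1 h2 h3 h4 =>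
    calc (1 + (a + b)) ^ p ≤ (3 * m) ^ p := by gcongr; linarith
      _ = 3 ^ p * m ^ p := Real.mul_rpow (by norm_num) h0
      _ ≤ _ := by gcongr
  rcases le_total a b with hab | hab
  · rcases le_total 1 b with h1 | h1
    · exact key hb h1 hab le_rfl (by linarith)
    · exact key zero_le_one le_rfl (hab.trans h1) h1 (by rw [Real.one_rpow]; linarith)
  · rcases le_total 1 a with h1 | h1
    · exact key ha h1 le_rfl hab (by linarith)
    · exact key zero_le_one le_rfl h1 (hab.trans h1) (by rw [Real.one_rpow]; linarith)

lemma lintegral_one_add_add_rpow_lt_top {Ω : Type*} [MeasurableSpace Ω] {P : Measure Ω}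
    [IsFiniteMeasure P] {a b : Ω → ℝ} {f g : Ω → ℝ≥0∞} {p : ℝ} (hp : 0 ≤ p)
    (ha : ∀ ω, 0 ≤ a ω) (hb : ∀ ω, 0 ≤ b ω) (hf : Measurable f)
    (haf : ∀ ω, ENNReal.ofReal (a ω ^ p) ≤ f ω) (hbg : ∀ ω, ENNReal.ofReal (b ω ^ p) ≤ g ω)
    (hfi : ∫⁻ ω, f ω ∂P < ⊤) (hgi : ∫⁻ ω, g ω ∂P < ⊤) :
    ∫⁻ ω, ENNReal.ofReal ((1 + (a ω + b ω)) ^ p) ∂P < ⊤ := by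
  have hle : ∀ ω, ENNReal.ofReal ((1 + (a ω + b ω)) ^ p) ≤
      ENNReal.ofReal (3 ^ p) * (1 + (f ω + g ω)) := fun ω => by
    refine (ENNReal.ofReal_le_ofReal (one_add_add_rpow_le (ha ω) (hb ω) hp)).trans ?_
    have h1 := Real.rpow_nonneg (ha ω) p
    have h2 := Real.rpow_nonneg (hb ω) p
    rw [ENNReal.ofReal_mul (by positivity), ENNReal.ofReal_add zero_le_one (by positivity),
      ENNReal.ofReal_add h1 h2, ENNReal.ofReal_one]
    gcongr
    exacts [haf ω, hbg ω]
  refine (lintegral_mono hle).trans_lt ?_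
  rw [lintegral_const_mul' _ _ ENNReal.ofReal_ne_top, lintegral_add_left measurable_const,
    lintegral_add_left hf, lintegral_one]
  exact ENNReal.mul_lt_top ENNReal.ofReal_lt_top
    (ENNReal.add_lt_top.2 ⟨measure_lt_top _ _, ENNReal.add_lt_top.2 ⟨hfi, hgi⟩⟩)

lemma countable_ratIcc (T : ℝ) : (ratIcc T).Countable :=
  (Set.countable_range _).mono Set.inter_subset_right

lemma mem_closure_ratIcc {T t : ℝ} (ht : t ∈ Set.Icc 0 T) : t ∈ closure (ratIcc T) := by
  rcases ht.1.eq_or_lt with rfl | h0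
  · exact subset_closure ⟨ht, 0, by simp⟩
  · have h1 : closure (Set.Ioo 0 t) ⊆ closure (Set.Ioo 0 t ∩ Set.range ((↑) : ℚ → ℝ)) :=
      closure_minimal (Rat.denseRange_cast.open_subset_closure_inter isOpen_Ioo) isClosed_closure
    rw [closure_Ioo h0.ne] at h1
    refine closure_mono (Set.inter_subset_inter_left _ fun s hs => ?_)
      (h1 (Set.right_mem_Icc.2 h0.le))
    exact ⟨hs.1.le, hs.2.le.trans ht.2⟩

lemma ofReal_le_iSup_ratIcc {T t : ℝ} {f : ℝ → ℝ} (hf : ContinuousOn f (Set.Icc 0 T))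
    (ht : t ∈ Set.Icc 0 T) :
    ENNReal.ofReal (f t) ≤ ⨆ s ∈ ratIcc T, ENNReal.ofReal (f s) := by
  have hc : ContinuousWithinAt (fun s => ENNReal.ofReal (f s)) (ratIcc T) t :=
    (ENNReal.continuous_ofReal.comp_continuousOn hf t ht).mono Set.inter_subset_left
  have : (nhdsWithin t (ratIcc T)).NeBot :=
    mem_closure_iff_nhdsWithin_neBot.1 (mem_closure_ratIcc ht)
  refine le_of_tendsto hc ?_
  filter_upwards [self_mem_nhdsWithin] with s hs
  exact le_iSup₂ (f := fun s _ => ENNReal.ofReal (f s)) s hs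

end Estimates

/-- **Proposition (regularity with respect to the initial value for additive
noise SDEs with general noise).** -/
theorem initial_value_regularity_general_noise
    (d m : ℕ) (hd : 0 < d) (hm : 0 < m)
    (T κ : ℝ) (hT : 0 ≤ T) (hκ : 0 ≤ κ)
    (μ : (Fin d → ℝ) → (Fin d → ℝ)) (hμ : ContDiff ℝ 1 μ)
    (σ : Matrix (Fin d) (Fin m) ℝ)
    (φ : (Fin m → ℝ) → ℝ) (hφc : Continuous φ) (hφ0 : ∀ z, 0 ≤ φ z)
    (V : (Fin d → ℝ) → ℝ) (hV : ContDiff ℝ 1 V) (hV0 : ∀ x, 0 ≤ V x)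
    (Nd : (Fin d → ℝ) → ℝ) (hNd : IsNorm Nd)
    (hgrow : ∀ x h : Fin d → ℝ, Nd (fderiv ℝ μ x h) ≤ κ * (1 + Nd x ^ κ) * Nd h)
    (hLyap : ∀ (x : Fin d → ℝ) (z : Fin m → ℝ),
      fderiv ℝ V x (μ (x + σ.mulVec z)) ≤ φ z * V x)
    (hNV : ∀ x, Nd x ≤ V x)
    {Ω : Type*} [MeasurableSpace Ω] (P : Measure Ω) [IsProbabilityMeasure P]
    (W : ℝ → Ω → (Fin m → ℝ))
    (hWmeas : ∀ t ∈ Set.Icc (0 : ℝ) T, Measurable (W t))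
    (hWcont : ∀ ω, ContinuousOn (fun t => W t ω) (Set.Icc (0 : ℝ) T))
    (hint : ∀ c : ℝ, 0 ≤ c →
      (∫⁻ ω, (⨆ t ∈ ratIcc T, ENNReal.ofReal (Real.exp (c * φ (W t ω)))) ∂P) +
      (∫⁻ ω, (⨆ t ∈ ratIcc T,
        ENNReal.ofReal (Nd (σ.mulVec (W t ω)) ^ c)) ∂P) < ⊤) :
    ∃ X : (Fin d → ℝ) → ℝ → Ω → (Fin d → ℝ),
      (IsSolution d m T μ σ W X ∧
        ∀ Y : (Fin d → ℝ) → ℝ → Ω → (Fin d → ℝ), IsSolution d m T μ σ W Y →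
          ∀ x : Fin d → ℝ, ∀ t ∈ Set.Icc (0 : ℝ) T, ∀ ω, Y x t ω = X x t ω) ∧
      (∀ R r : ℝ, 0 ≤ R → 0 ≤ r →
        (⨆ x ∈ {z : Fin d → ℝ | Nd z ≤ R}, ⨆ t ∈ Set.Icc (0 : ℝ) T,
          ∫⁻ ω, ENNReal.ofReal (Nd (X x t ω) ^ r) ∂P) < ⊤) ∧
      (∀ R q : ℝ, 0 ≤ R → 0 ≤ q → ∃ c : ℝ, 0 < c ∧
        ∀ h : Fin d → ℝ, 0 < Nd h → Nd h < 1 →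
          ∀ x : Fin d → ℝ, Nd x ≤ R → ∀ t ∈ Set.Icc (0 : ℝ) T,
            (∫⁻ ω, ENNReal.ofReal (Nd (X (x + h) t ω - X x t ω)) ∂P) ≤
              ENNReal.ofReal (c * |Real.log (Nd h)| ^ (-q))) := by
  let w : ℝ → Ω → Fin d → ℝ := fun t ω => σ.mulVec (W (Set.projIcc 0 T hT t) ω)
  have hweq : ∀ t ∈ Set.Icc 0 T, ∀ ω, w t ω = σ.mulVec (W t ω) := fun t ht ω => by
    simp only [w, Set.projIcc_of_mem hT ht]
  have hσ : Continuous σ.mulVec := Continuous.matrix_mulVec continuous_const continuous_id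
  have hw : ∀ ω, Continuous fun t => w t ω := fun ω => hσ.comp <|
    (hWcont ω).comp_continuous (continuous_subtype_val.comp continuous_projIcc)
      fun t => (Set.projIcc 0 T hT t).2
  have hwm : ∀ t, Measurable (w t) := fun t =>
    hσ.measurable.comp (hWmeas _ (Set.projIcc 0 T hT t).2)
  have hφW : ∀ ω, ContinuousOn (fun t => φ (W t ω)) (Set.Icc 0 T) := fun ω =>
    hφc.comp_continuousOn (hWcont ω)
  have hNW : ∀ ω, ContinuousOn (fun t => Nd (σ.mulVec (W t ω))) (Set.Icc 0 T) := fun ω =>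
    (hNd.continuous.comp hσ).comp_continuousOn (hWcont ω)
  have hne : (Set.Icc 0 T).Nonempty := Set.nonempty_Icc.2 hT
  choose τ hτ hτmax using fun ω => isCompact_Icc.exists_isMaxOn hne (hφW ω)
  choose ρ hρ hρmax using fun ω => isCompact_Icc.exists_isMaxOn hne (hNW ω)
  set Φ : Ω → ℝ := fun ω => φ (W (τ ω) ω) with hΦdef
  set B : Ω → ℝ := fun ω => Nd (σ.mulVec (W (ρ ω) ω))
  have hΦ0 : ∀ ω, 0 ≤ Φ ω := fun ω => hφ0 _
  have hB0 : ∀ ω, 0 ≤ B ω := fun ω => hNd.nonneg _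
  have hLyap' : ∀ ω, ∀ t ∈ Set.Icc 0 T, ∀ z, fderiv ℝ V z (μ (z + w t ω)) ≤ Φ ω * V z := by
    intro ω t ht z
    rw [hweq t ht ω]
    exact (hLyap z _).trans (mul_le_mul_of_nonneg_right (hτmax ω ht) (hV0 z))
  have hmoment : ∀ S p : ℝ, 0 ≤ S → 0 ≤ p →
      ∫⁻ ω, ENNReal.ofReal ((1 + (S * Real.exp (Φ ω * T) + B ω)) ^ p) ∂P < ⊤ := by
    intro S p hS hp
    have hI := ENNReal.add_lt_top.1 (hint (T * p) (by positivity))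
    have hI' := ENNReal.add_lt_top.1 (hint p hp)
    refine lintegral_one_add_add_rpow_lt_top hp (fun ω => by positivity) hB0
      (f := fun ω => ENNReal.ofReal (S ^ p) *
        ⨆ t ∈ ratIcc T, ENNReal.ofReal (Real.exp (T * p * φ (W t ω))))
      (Measurable.const_mul (Measurable.biSup _ (countable_ratIcc T) fun t ht => ?_) _)
      (fun ω => ?_) (fun ω => ?_) ?_ hI'.2
    · exact ENNReal.measurable_ofReal.comp (Real.measurable_exp.comp
        ((hφc.measurable.comp (hWmeas t ht.1)).const_mul _))
    · rw [Real.mul_rpow hS (Real.exp_pos _).le, ENNReal.ofReal_mul (by positivity),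
        ← Real.exp_mul]
      gcongr
      refine le_of_eq_of_le ?_ (ofReal_le_iSup_ratIcc
        (f := fun t => Real.exp (T * p * φ (W t ω)))
        (Real.continuous_exp.comp_continuousOn (continuousOn_const.mul (hφW ω))) (hτ ω))
      simp only [hΦdef]
      ring_nf
    · exact ofReal_le_iSup_ratIcc (f := fun t => Nd (σ.mulVec (W t ω)) ^ p)
        ((hNW ω).rpow_const fun _ _ => Or.inr hp) (hρ ω)
    · rw [lintegral_const_mul' _ _ ENNReal.ofReal_ne_top]
      exact ENNReal.mul_lt_top ENNReal.ofReal_lt_top hI.1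
  choose y hy hym using
    exists_measurable_solvesIVP hT hNd hμ hκ hgrow hV hV0 hNV hw hwm hΦ0 hLyap'
  have hVball : ∀ R, ∃ S, 0 ≤ S ∧ ∀ x, Nd x ≤ R → V x ≤ S := fun R => by
    obtain ⟨S, hS⟩ := (hNd.isCompact_le R).exists_bound_of_continuousOn hV.continuous.continuousOn
    exact ⟨max S 0, le_max_right _ _,
      fun x hx => (le_abs_self _).trans ((hS x hx).trans (le_max_left _ _))⟩
  have hbound : ∀ {x S}, V x ≤ S → ∀ ω, ∀ t ∈ Set.Icc 0 T,
      Nd (y x t ω + w t ω) ≤ S * Real.exp (Φ ω * T) + B ω := by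
    intro x S hS ω t ht
    refine (hNd.2.2 _ _).trans (add_le_add ((hNV _).trans ?_) ?_)
    · refine (lyapunov_le_mul_exp hV hV0 (hΦ0 ω)
        (fun p => ⟨1, ⟨zero_le_one, le_rfl⟩, (one_smul _ _).symm⟩) (hy x ω) (hLyap' ω) ht).trans ?_
      gcongr
    · rw [hweq t ht ω]
      exact hρmax ω ht
  have hcont : Continuous fun p : (Fin d → ℝ) × (Fin d → ℝ) => μ (p.1 + p.2) :=
    hμ.continuous.comp (continuous_fst.add continuous_snd)
  refine ⟨fun x t ω => y x t ω + w t ω, ⟨fun x => ⟨fun t ht => (hym x t ht).add (hwm t),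
    fun ω => (hy x ω).continuousOn.add (hw ω).continuousOn, fun t ht ω => ?_⟩,
    fun Y hY x t ht ω => ?_⟩, fun R r hR hr => ?_, fun R q hR hq => ?_⟩
  · rw [← hweq t ht ω]
    exact congrArg (· + w t ω) ((hy x ω).eq_integral hcont (hw ω) ht)
  · have hsol : SolvesIVP (fun p => μ (p.1 + p.2)) T (fun t => w t ω) x
        fun t => Y x t ω - w t ω := by
      refine solvesIVP_of_eq_integral hT hcont (hw ω)
        (((hY x).2.1 ω).sub (hw ω).continuousOn) fun s hs => ?_
      simp only [sub_add_cancel]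
      rw [(hY x).2.2 s hs ω, hweq s hs ω, add_sub_cancel_right]
    have h := hsol.unique hNd hμ hκ hgrow (hw ω) (hy x ω) ht
    exact sub_eq_iff_eq_add.1 h
  · obtain ⟨S, hS0, hS⟩ := hVball R
    refine lt_of_le_of_lt (iSup₂_le fun x hx => iSup₂_le fun t ht => ?_) (hmoment S r hS0 hr)
    refine lintegral_mono fun ω => ENNReal.ofReal_le_ofReal ?_
    refine Real.rpow_le_rpow (hNd.nonneg _) ?_ hr
    linarith [hbound (hS x hx) ω t ht]
  · obtain ⟨S, hS0, hS⟩ := hVball (R + 1)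
    have hp : 0 ≤ 1 + κ * q := by positivity
    have hI := hmoment S (1 + κ * q) hS0 hp
    set I := ∫⁻ ω, ENNReal.ofReal ((1 + (S * Real.exp (Φ ω * T) + B ω)) ^ (1 + κ * q)) ∂P
    set c₀ : ℝ := 2 * (4 * (κ * T)) ^ q + (2 * (q + 1)) ^ q
    have hc₀' : 0 ≤ c₀ := by positivity
    refine ⟨c₀ * I.toReal + 1, by positivity, fun h hh0 hh1 x hx t ht => ?_⟩
    have hpath : ∀ ω, Nd (y (x + h) t ω + w t ω - (y x t ω + w t ω)) ≤
        c₀ * |Real.log (Nd h)| ^ (-q) *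
          (1 + (S * Real.exp (Φ ω * T) + B ω)) ^ (1 + κ * q) := by
      intro ω
      obtain ⟨M, hM⟩ : ∃ M, M = S * Real.exp (Φ ω * T) + B ω := ⟨_, rfl⟩
      have hM0 : 0 ≤ M := by
        rw [hM]
        exact add_nonneg (by positivity) (hB0 ω)
      have hb₁ := hbound (hS (x + h) ((hNd.2.2 x h).trans (add_le_add hx hh1.le))) ω
      have hb₂ := hbound (hS x (by linarith)) ω
      rw [← hM] at hb₁ hb₂ ⊢
      have hD₁ := hNd.sub_le_of_solvesIVP hμ hκ hgrow hM0 (hy (x + h) ω) (hy x ω) hb₁ hb₂ ht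
      rw [add_sub_cancel_left, ← add_sub_add_right_eq_sub _ _ (w t ω)] at hD₁
      have hD₂ : Nd (y (x + h) t ω + w t ω - (y x t ω + w t ω)) ≤ 2 * M := by
        linarith [hNd.sub_le (y (x + h) t ω + w t ω) (y x t ω + w t ω), hb₁ t ht, hb₂ t ht]
      have hA0 : 0 ≤ κ * (1 + M ^ κ) * T := by positivity
      refine (le_mul_abs_log_rpow hh0 hh1 hA0 hM0 hq hD₁ hD₂).trans ?_
      rw [mul_right_comm c₀]
      refine mul_le_mul_of_nonneg_right ?_ (by positivity)
      exact two_mul_rpow_add_le hκ hT hM0 hq (by positivity)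
    calc ∫⁻ ω, ENNReal.ofReal (Nd (y (x + h) t ω + w t ω - (y x t ω + w t ω))) ∂P
        ≤ ∫⁻ ω, ENNReal.ofReal (c₀ * |Real.log (Nd h)| ^ (-q)) *
            ENNReal.ofReal ((1 + (S * Real.exp (Φ ω * T) + B ω)) ^ (1 + κ * q)) ∂P := by
          refine lintegral_mono fun ω => ?_
          rw [← ENNReal.ofReal_mul (by positivity)]
          exact ENNReal.ofReal_le_ofReal (hpath ω)
      _ = ENNReal.ofReal (c₀ * |Real.log (Nd h)| ^ (-q) * I.toReal) := by
          rw [lintegral_const_mul' _ _ ENNReal.ofReal_ne_top,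
            ENNReal.ofReal_mul (p := c₀ * |Real.log (Nd h)| ^ (-q)) (by positivity),
            ENNReal.ofReal_toReal hI.ne]
      _ ≤ _ := by
          refine ENNReal.ofReal_le_ofReal ?_
          rw [mul_right_comm]
          gcongr
          linarith
end
end

section
/- Let d,m ∈ ℕ, T ∈ [0,∞), let μ ∈ C¹(ℝ^d,ℝ^d), σ ∈ ℝ^{d×m}, φ ∈ C(ℝ^m,[0,∞)), V ∈ C¹(ℝ^d,[0,∞)), let ‖·‖ be a norm on ℝ^d, assume for all x ∈ ℝ^d and z ∈ ℝ^m that V'(x)μ(x+σz) ≤ φ(z)V(x) and ‖x‖ ≤ V(x), let (Ω,ℱ,ℙ) be a probability space, and let W: [0,T]×Ω → ℝ^m be a stochastic process with continuous sample paths. Then (i) there exist unique stochastic processes X^x: [0,T]×Ω → ℝ^d, x ∈ ℝ^d, with continuous sample paths satisfying X^x(t,ω) = x + ∫₀^t μ(X^x(s,ω)) ds + σW(t,ω) for all x ∈ ℝ^d, t ∈ [0,T], ω ∈ Ω; (ii) for every ω ∈ Ω the map (t,x) ↦ X^x(t,ω) belongs to C^{0,1}([0,T]×ℝ^d,ℝ^d);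 and (iii) for all x,h ∈ ℝ^d, t ∈ [0,T], ω ∈ Ω it holds that (∂/∂x X^x(t,ω))(h) = h + ∫₀^t μ'(X^x(s,ω))((∂/∂x X^x(s,ω))(h)) ds. -/
open MeasureTheory ProbabilityTheory Filter
open scoped ENNReal NNReal

noncomputable section

/-- `g` belongs to `C^{0,1}([0,T] × ℝ^d, ℝ^d)`: `g` is continuous on
`[0,T] × ℝ^d`, for every `t ∈ [0,T]` the map `x ↦ g t x` is differentiable,
and `(t,x) ↦ ∂/∂x g(t,x)` is continuous on `[0,T] × ℝ^d`. -/
def IsC01 (d : ℕ) (T : ℝ) (g : ℝ → (Fin d → ℝ) → (Fin d → ℝ)) : Prop :=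
  ContinuousOn (fun p : ℝ × (Fin d → ℝ) => g p.1 p.2) (Set.Icc 0 T ×ˢ Set.univ) ∧
  (∀ t ∈ Set.Icc (0 : ℝ) T, Differentiable ℝ (g t)) ∧
  ContinuousOn (fun p : ℝ × (Fin d → ℝ) => fderiv ℝ (g p.1) p.2)
    (Set.Icc 0 T ×ˢ Set.univ)


open scoped Topology

namespace ODE

variable {E : Type*} [NormedAddCommGroup E] [NormedSpace ℝ E]

/-- `u` is a continuous solution on `[0, T]` of the integral equation
`u t = x + ∫_0^t F s (u s) ds`. -/
structure IsPicardSolution (F : ℝ → E → E) (T : ℝ) (x : E) (u : ℝ → E) : Prop where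
  continuousOn : ContinuousOn u (Set.Icc 0 T)
  eq_picard : ∀ t ∈ Set.Icc 0 T, u t = picard F 0 x u t

lemma continuous_picard {F : ℝ → E → E} (hF : Continuous (Function.uncurry F)) (x : E)
    {u : ℝ → E} (hu : Continuous u) : Continuous (picard F 0 x u) :=
  continuous_const.add <| intervalIntegral.continuous_primitive
    (fun _ _ ↦ (hF.comp (continuous_id.prodMk hu)).intervalIntegrable _ _) 0

lemma continuous_iterate_picard {F : ℝ → E → E} (hF : Continuous (Function.uncurry F)) (x : E)
    {u : ℝ → E} (hu : Continuous u) (n : ℕ) : Continuous ((picard F 0 x)^[n] u) := by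
  induction n with
  | zero => exact hu
  | succ n ih =>
    rw [Function.iterate_succ_apply']
    exact continuous_picard hF x ih

lemma picard_congr {F : ℝ → E → E} {x : E} {T : ℝ} {u v : ℝ → E}
    (h : Set.EqOn u v (Set.Icc 0 T)) :
    Set.EqOn (picard F 0 x u) (picard F 0 x v) (Set.Icc 0 T) := by
  intro t ht
  simp only [picard_apply]
  congr 1
  refine intervalIntegral.integral_congr fun s hs ↦ ?_
  rw [Set.uIcc_of_le ht.1] at hs
  simp only [h ⟨hs.1, hs.2.trans ht.2⟩]

lemma iterate_picard_congr {F : ℝ → E → E} {x : E} {T : ℝ} {u v : ℝ → E}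
    (h : Set.EqOn u v (Set.Icc 0 T)) (n : ℕ) :
    Set.EqOn ((picard F 0 x)^[n] u) ((picard F 0 x)^[n] v) (Set.Icc 0 T) := by
  induction n with
  | zero => exact h
  | succ n ih =>
    simp only [Function.iterate_succ_apply']
    exact picard_congr ih

/-- The iterates of the Picard operator of a Lipschitz field contract factorially fast. -/
lemma dist_iterate_picard_le {F : ℝ → E → E} (hF : Continuous (Function.uncurry F)) {K : ℝ≥0}
    (hK : ∀ t, LipschitzWith K (F t)) (x : E) {T C : ℝ} {u v : ℝ → E} (hu : Continuous u)
    (hv : Continuous v) (huv : ∀ t ∈ Set.Icc 0 T, dist (u t) (v t) ≤ C) (n : ℕ) :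
    ∀ t ∈ Set.Icc 0 T, dist ((picard F 0 x)^[n] u t) ((picard F 0 x)^[n] v t) ≤
      C * (K * t) ^ n / n.factorial := by
  induction n with
  | zero => simpa using huv
  | succ n ih =>
    intro t ht
    have hu' := continuous_iterate_picard hF x hu n
    have hv' := continuous_iterate_picard hF x hv n
    have hFi : ∀ {w : ℝ → E}, Continuous w → IntervalIntegrable (fun s ↦ F s (w s)) volume 0 t :=
      fun hw ↦ (hF.comp (continuous_id.prodMk hw)).intervalIntegrable _ _
    simp only [Function.iterate_succ_apply', picard_apply]
    rw [dist_add_left, dist_eq_norm, ← intervalIntegral.integral_sub (hFi hu') (hFi hv')]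
    calc _ ≤ ∫ s in (0 : ℝ)..t, K * (C * (K * s) ^ n / n.factorial) := by
          refine intervalIntegral.norm_integral_le_of_norm_le ht.1 (.of_forall fun s hs ↦ ?_)
            (Continuous.intervalIntegrable (by fun_prop) _ _)
          rw [← dist_eq_norm]
          refine ((hK s).dist_le_mul _ _).trans ?_
          gcongr
          exact ih s ⟨hs.1.le, hs.2.trans ht.2⟩
      _ = (K * (C * K ^ n / n.factorial)) * ∫ s in (0 : ℝ)..t, s ^ n := by
          rw [← intervalIntegral.integral_const_mul]
          congr 1 with s
          ring
      _ = _ := by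
          rw [integral_pow, Nat.factorial_succ]
          push_cast
          field_simp
          ring

/-- A continuous field which is Lipschitz in space has solutions on every interval `[0, T]`. -/
lemma exists_isPicardSolution [CompleteSpace E] {F : ℝ → E → E}
    (hF : Continuous (Function.uncurry F)) {K : ℝ≥0} (hK : ∀ t, LipschitzWith K (F t)) {T : ℝ}
    (hT : 0 ≤ T) (x : E) : ∃ u, IsPicardSolution F T x u := by
  let e : C(Set.Icc 0 T, E) → ℝ → E := fun u ↦ Set.IccExtend hT u
  have he : ∀ u, Continuous (e u) := fun u ↦ u.continuous.Icc_extend'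
  let Φ : C(Set.Icc 0 T, E) → C(Set.Icc 0 T, E) := fun u ↦
    ⟨fun t ↦ picard F 0 x (e u) t, (continuous_picard hF x (he u)).comp continuous_subtype_val⟩
  have hΦe : ∀ u, Set.EqOn (e (Φ u)) (picard F 0 x (e u)) (Set.Icc 0 T) := fun u t ht ↦
    Set.IccExtend_of_mem hT _ ht
  have hΦ : ∀ n u, ∀ t : Set.Icc 0 T, (Φ^[n] u) t = (picard F 0 x)^[n] (e u) t := by
    intro n
    induction n with
    | zero => exact fun u t ↦ (Set.IccExtend_val hT _ t).symm
    | succ n ih =>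
      intro u t
      rw [Function.iterate_succ_apply, ih, Function.iterate_succ_apply]
      exact iterate_picard_congr (hΦe u) n t.2
  obtain ⟨n, hn⟩ := (FloorSemiring.tendsto_pow_div_factorial_atTop (K * T : ℝ)).eventually
    (gt_mem_nhds zero_lt_one) |>.exists
  have hC : (0 : ℝ) ≤ (K * T) ^ n / n.factorial := by positivity
  have hcontr : ContractingWith ⟨_, hC⟩ Φ^[n] := by
    refine ⟨hn, LipschitzWith.of_dist_le_mul fun u v ↦ ?_⟩
    refine (ContinuousMap.dist_le (by positivity)).2 fun t ↦ ?_
    rw [hΦ, hΦ]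
    refine (dist_iterate_picard_le hF hK x (he u) (he v) (C := dist u v) (fun s hs ↦ ?_) n t
      t.2).trans ?_
    · exact ContinuousMap.dist_apply_le_dist _
    · rw [mul_div_assoc, mul_comm]
      change _ ≤ (K * T) ^ n / n.factorial * dist u v
      have := t.2.1
      gcongr
      exact t.2.2
  have hfix := hcontr.isFixedPt_fixedPoint_iterate
  refine ⟨e (ContractingWith.fixedPoint _ hcontr), (he _).continuousOn, fun t ht ↦ ?_⟩
  rw [← hΦe _ ht, hfix]

/-- Picard iterates converge to the solution. -/
lemma IsPicardSolution.tendsto_iterate_picard {F : ℝ → E → E}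
    (hF : Continuous (Function.uncurry F)) {K : ℝ≥0} (hK : ∀ t, LipschitzWith K (F t)) {T : ℝ}
    {x : E} {u : ℝ → E} (hu : IsPicardSolution F T x u) {t : ℝ} (ht : t ∈ Set.Icc 0 T) :
    Tendsto (fun n ↦ (picard F 0 x)^[n] (fun _ ↦ x) t) atTop (𝓝 (u t)) := by
  have hT := ht.1.trans ht.2
  have huc : Continuous (Set.IccExtend hT ((Set.Icc 0 T).domRestrict u)) :=
    hu.continuousOn.domRestrict.Icc_extend'
  set v := Set.IccExtend hT ((Set.Icc 0 T).domRestrict u)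
  have hvu : Set.EqOn v u (Set.Icc 0 T) := fun s hs ↦ Set.IccExtend_of_mem hT _ hs
  have hv : ∀ n, (picard F 0 x)^[n] v t = u t := by
    have : ∀ n, Set.EqOn ((picard F 0 x)^[n] v) u (Set.Icc 0 T) := by
      intro n
      induction n with
      | zero => exact hvu
      | succ n ih =>
        intro s hs
        rw [Function.iterate_succ_apply', picard_congr ih hs, hu.eq_picard s hs]
    exact fun n ↦ this n ht
  obtain ⟨C, hC⟩ := (isCompact_Icc (a := 0) (b := T)).exists_bound_of_continuousOn
    (f := fun s ↦ x - v s) (by fun_prop)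
  rw [tendsto_iff_dist_tendsto_zero]
  refine squeeze_zero (fun _ ↦ dist_nonneg) (fun n ↦ ?_)
    (g := fun n : ℕ ↦ C * ((K * t) ^ n / n.factorial)) ?_
  · rw [← mul_div_assoc, ← hv n]
    exact dist_iterate_picard_le hF hK x continuous_const huc
      (fun s hs ↦ by rw [dist_eq_norm]; exact hC s hs) n t ht
  · simpa using (FloorSemiring.tendsto_pow_div_factorial_atTop (K * t : ℝ)).const_mul C

lemma IsPicardSolution.apply_zero {F : ℝ → E → E} {T : ℝ} (hT : 0 ≤ T) {x : E} {u : ℝ → E}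
    (hu : IsPicardSolution F T x u) : u 0 = x := by
  rw [hu.eq_picard 0 ⟨le_rfl, hT⟩, picard_apply₀]

lemma IsPicardSolution.hasDerivWithinAt [CompleteSpace E] {F : ℝ → E → E}
    (hF : Continuous (Function.uncurry F)) {T : ℝ} {x : E} {u : ℝ → E}
    (hu : IsPicardSolution F T x u) {t : ℝ} (ht : t ∈ Set.Ico 0 T) :
    HasDerivWithinAt u (F t (u t)) (Set.Ici t) t := by
  have ht' := Set.Ico_subset_Icc_self ht
  refine ((hasDerivWithinAt_picard_Icc ⟨le_rfl, ht.1.trans ht.2.le⟩ (u := Set.univ)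
    hF.continuousOn hu.continuousOn (fun _ _ ↦ Set.mem_univ _) x ht').congr
    hu.eq_picard (hu.eq_picard t ht')).mono_of_mem_nhdsWithin (Icc_mem_nhdsGE_of_mem ht)

lemma gronwallBound_le_mul {δ ε K T t : ℝ} (hδ : 0 ≤ δ) (hε : 0 ≤ ε) (hK : 0 ≤ K)
    (hT : 0 ≤ T) (h1 : t ≤ T) :
    gronwallBound δ K ε t ≤ (δ + ε) * gronwallBound 1 K 1 T := by
  refine (gronwallBound_mono hδ hε hK h1).trans ?_
  have h0 : gronwallBound δ K ε T = δ * gronwallBound 1 K 0 T + ε * gronwallBound 0 K 1 T := by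
    unfold gronwallBound
    split_ifs <;> ring
  have h2 : gronwallBound 1 K 1 T = gronwallBound 1 K 0 T + gronwallBound 0 K 1 T := by
    unfold gronwallBound
    split_ifs <;> ring
  have h3 : 0 ≤ gronwallBound 1 K 0 T := by
    rw [gronwallBound_ε0]
    positivity
  have h4 : 0 ≤ gronwallBound 0 K 1 T := by
    simpa [gronwallBound_x0] using gronwallBound_mono le_rfl zero_le_one hK hT
  rw [h0, h2]
  nlinarith [mul_nonneg hδ h4, mul_nonneg hε h3]

/-- An approximate solution starting close to `x` stays close to the solution. -/
lemma IsPicardSolution.dist_le [CompleteSpace E] {F : ℝ → E → E}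
    (hF : Continuous (Function.uncurry F)) {K : ℝ≥0} (hK : ∀ t, LipschitzWith K (F t)) {T : ℝ}
    {x : E} {u v v' : ℝ → E} {δ ε : ℝ} (hδ : 0 ≤ δ) (hε : 0 ≤ ε) (hu : IsPicardSolution F T x u)
    (hv : ContinuousOn v (Set.Icc 0 T))
    (hv' : ∀ t ∈ Set.Ico 0 T, HasDerivWithinAt v (v' t) (Set.Ici t) t)
    (hvF : ∀ t ∈ Set.Ico 0 T, dist (v' t) (F t (v t)) ≤ ε) (h0 : dist (v 0) x ≤ δ) {t : ℝ}
    (ht : t ∈ Set.Icc 0 T) : dist (v t) (u t) ≤ (δ + ε) * gronwallBound 1 K 1 T := by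
  have hT := ht.1.trans ht.2
  refine (dist_le_of_approx_trajectories_ODE (δ := δ) hK hv hv' hvF hu.continuousOn
    (fun s hs ↦ hu.hasDerivWithinAt hF hs) (fun s _ ↦ (dist_self _).le)
    (by rwa [hu.apply_zero hT]) t ht).trans ?_
  rw [add_zero, sub_zero]
  exact gronwallBound_le_mul hδ hε K.2 hT ht.2

/-- Solutions depend Lipschitz continuously on the initial value. -/
lemma IsPicardSolution.dist_le_of_isPicardSolution [CompleteSpace E] {F : ℝ → E → E}
    (hF : Continuous (Function.uncurry F)) {K : ℝ≥0} (hK : ∀ t, LipschitzWith K (F t)) {T : ℝ}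
    {x y : E} {u v : ℝ → E} (hu : IsPicardSolution F T x u) (hv : IsPicardSolution F T y v)
    {t : ℝ} (ht : t ∈ Set.Icc 0 T) : dist (v t) (u t) ≤ gronwallBound 1 K 1 T * dist y x := by
  have hT := ht.1.trans ht.2
  refine (hu.dist_le hF hK (dist_nonneg (x := y) (y := x)) le_rfl hv.continuousOn
    (fun s hs ↦ hv.hasDerivWithinAt hF hs) (fun s _ ↦ (dist_self _).le)
    (by rw [hv.apply_zero hT]) ht).trans_eq (by ring)

end ODE

lemma Continuous.uncurry_comp_add {E G : Type*} [TopologicalSpace E] [Add E] [ContinuousAdd E]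
    [TopologicalSpace G] {f : E → G} (hf : Continuous f) {w : ℝ → E} (hw : Continuous w) :
    Continuous (Function.uncurry fun t y ↦ f (y + w t)) :=
  hf.comp (continuous_snd.add (hw.comp continuous_fst))

lemma LipschitzWith.comp_add_right {E G : Type*} [NormedAddCommGroup E] [NormedAddCommGroup G]
    {f : E → G} {K : ℝ≥0} (hf : LipschitzWith K f) (a : E) :
    LipschitzWith K fun y ↦ f (y + a) :=
  LipschitzWith.of_dist_le_mul fun y z ↦ by simpa using hf.dist_le_mul (y + a) (z + a)

/-- A `C¹` map with compact support is uniformly differentiable. -/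
lemma HasCompactSupport.exists_norm_sub_sub_fderiv_le {E G : Type*} [NormedAddCommGroup E]
    [NormedSpace ℝ E] [NormedAddCommGroup G] [NormedSpace ℝ G] {f : E → G}
    (hfs : HasCompactSupport f) (hf : ContDiff ℝ 1 f) {ε : ℝ} (hε : 0 < ε) :
    ∃ δ > 0, ∀ y v, ‖v‖ < δ → ‖f (y + v) - f y - fderiv ℝ f y v‖ ≤ ε * ‖v‖ := by
  have huc : UniformContinuous (fderiv ℝ f) :=
    (hfs.fderiv ℝ).uniformContinuous_of_continuous (hf.continuous_fderiv one_ne_zero)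
  obtain ⟨δ, hδ, h⟩ := Metric.uniformContinuous_iff.1 huc ε hε
  refine ⟨δ, hδ, fun y v hv ↦ ?_⟩
  have := (convex_ball y δ).norm_image_sub_le_of_norm_hasFDerivWithin_le' (f := f)
    (f' := fderiv ℝ f) (φ := fderiv ℝ f y) (C := ε) (x := y) (y := y + v)
    (fun z _ ↦ (hf.differentiable one_ne_zero z).hasFDerivAt.hasFDerivWithinAt)
    (fun z hz ↦ by rw [← dist_eq_norm]; exact (h hz).le)
    (Metric.mem_ball_self hδ) (by simpa using hv)
  simpa using this

/-- A family of curves which are continuous in time and uniformly continuous with respect to the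
parameter is jointly continuous. -/
lemma continuousOn_uncurry_of_uniform {A B : Type*} [PseudoMetricSpace A] [PseudoMetricSpace B]
    {s : Set ℝ} {g : A → ℝ → B} (hg : ∀ a, ContinuousOn (g a) s)
    (hu : ∀ a, ∀ ε > 0, ∃ δ > 0, ∀ a', dist a' a < δ → ∀ t ∈ s, dist (g a' t) (g a t) ≤ ε) :
    ContinuousOn (fun p : ℝ × A ↦ g p.2 p.1) (s ×ˢ Set.univ) := by
  rintro ⟨t, a⟩ ⟨ht, -⟩
  rw [ContinuousWithinAt, Metric.tendsto_nhds]
  intro ε hε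
  obtain ⟨δ, hδ, h⟩ := hu a (ε / 2) (half_pos hε)
  have h1 : ∀ᶠ r in 𝓝[s] t, dist (g a r) (g a t) < ε / 2 :=
    Metric.tendsto_nhds.1 (hg a t ht) _ (half_pos hε)
  rw [nhdsWithin_prod_eq, nhdsWithin_univ]
  filter_upwards [(h1.and self_mem_nhdsWithin).prod_mk (Metric.ball_mem_nhds a hδ)]
    with p ⟨⟨hp1, hps⟩, hp2⟩
  linarith [dist_triangle (g p.2 p.1) (g a p.1) (g a t), h p.2 hp2 p.1 hps]

namespace ODE

variable {E : Type*} [NormedAddCommGroup E] [NormedSpace ℝ E] [CompleteSpace E]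

/-- The flow of a compactly supported `C¹` field driven by an additive continuous perturbation
is `C¹` in the initial value, and its derivative solves the variational equation. -/
theorem exists_flow_of_hasCompactSupport {f : E → E} (hf : ContDiff ℝ 1 f)
    (hfs : HasCompactSupport f) {w : ℝ → E} (hw : Continuous w) {T : ℝ} (hT : 0 ≤ T)
    {Y : E → ℝ → E} (hY : ∀ x, IsPicardSolution (fun t y ↦ f (y + w t)) T x (Y x)) :
    ∃ Z : E → ℝ → E →L[ℝ] E,
      (∀ x, ContinuousOn (Z x) (Set.Icc 0 T)) ∧
      (∀ x, ∀ t ∈ Set.Icc 0 T, Z x t = ContinuousLinearMap.id ℝ E +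
        ∫ s in (0 : ℝ)..t, (fderiv ℝ f (Y x s + w s)).comp (Z x s)) ∧
      (∀ x, ∀ t ∈ Set.Icc 0 T, HasFDerivAt (fun y ↦ Y y t) (Z x t) x) ∧
      ContinuousOn (fun p : ℝ × E ↦ Y p.2 p.1) (Set.Icc 0 T ×ˢ Set.univ) ∧
      ContinuousOn (fun p : ℝ × E ↦ Z p.2 p.1) (Set.Icc 0 T ×ˢ Set.univ) := by
  obtain ⟨K, hK⟩ := hf.lipschitzWith_of_hasCompactSupport hfs one_ne_zero
  have hfc : Continuous (fderiv ℝ f) := hf.continuous_fderiv one_ne_zero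
  have hKf : ∀ y, ‖fderiv ℝ f y‖ ≤ K := fun y ↦ norm_fderiv_le_of_lipschitz ℝ hK
  have huc : UniformContinuous (fderiv ℝ f) :=
    (hfs.fderiv ℝ).uniformContinuous_of_continuous hfc
  have hF : Continuous (Function.uncurry fun t y ↦ f (y + w t)) :=
    hf.continuous.uncurry_comp_add hw
  have hFK : ∀ t, LipschitzWith K fun y ↦ f (y + w t) := fun t ↦ hK.comp_add_right (w t)
  set M := gronwallBound 1 K 1 T
  have hM : 1 ≤ M := by
    simpa [gronwallBound_x0] using gronwallBound_mono zero_le_one zero_le_one K.2 hT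
  have hYd : ∀ x y, ∀ t ∈ Set.Icc 0 T, dist (Y y t) (Y x t) ≤ M * dist y x :=
    fun x y t ht ↦ (hY x).dist_le_of_isPicardSolution hF hFK (hY y) ht
  let yc : E → ℝ → E := fun x ↦ Set.IccExtend hT ((Set.Icc 0 T).domRestrict (Y x))
  have hyc : ∀ x, Continuous (yc x) := fun x ↦ (hY x).continuousOn.domRestrict.Icc_extend'
  have hycY : ∀ x, Set.EqOn (yc x) (Y x) (Set.Icc 0 T) := fun x t ht ↦
    Set.IccExtend_of_mem hT _ ht
  let A : E → ℝ → (E →L[ℝ] E) → (E →L[ℝ] E) := fun x t L ↦ (fderiv ℝ f (yc x t + w t)).comp L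
  have hA : ∀ x, Continuous (Function.uncurry (A x)) := fun x ↦
    (hfc.comp (((hyc x).add hw).comp continuous_fst)).clm_comp continuous_snd
  have hAK : ∀ x t, LipschitzWith K (A x t) := fun x t ↦ by
    refine LipschitzWith.of_dist_le_mul fun L L' ↦ ?_
    rw [dist_eq_norm, dist_eq_norm]
    simp only [A]
    rw [← ContinuousLinearMap.comp_sub]
    exact (ContinuousLinearMap.opNorm_comp_le _ _).trans (by gcongr; exact hKf _)
  choose Z hZ using fun x ↦ exists_isPicardSolution (hA x) (hAK x) hT (ContinuousLinearMap.id ℝ E)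
  have hZM : ∀ x, ∀ t ∈ Set.Icc 0 T, ‖Z x t‖ ≤ M := by
    intro x t ht
    have h := (hZ x).dist_le (hA x) (hAK x) (v := fun _ ↦ 0) (v' := fun _ ↦ 0) zero_le_one le_rfl
      continuousOn_const (fun _ _ ↦ hasDerivWithinAt_const _ _ _) (by simp [A])
      (by simpa using ContinuousLinearMap.norm_id_le) ht
    simpa using h
  refine ⟨Z, fun x ↦ (hZ x).continuousOn, ?_, ?_, ?_, ?_⟩
  · intro x t ht
    rw [(hZ x).eq_picard t ht, picard_apply]
    congr 1
    refine intervalIntegral.integral_congr fun s hs ↦ ?_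
    rw [Set.uIcc_of_le ht.1] at hs
    simp only [A, hycY x ⟨hs.1, hs.2.trans ht.2⟩]
  · intro x t ht
    rw [hasFDerivAt_iff_isLittleO_nhds_zero, Asymptotics.isLittleO_iff]
    intro c hc
    have hc' : 0 < c / (M * M) := by positivity
    obtain ⟨δ, hδ, h⟩ := hfs.exists_norm_sub_sub_fderiv_le hf hc'
    have hδM : 0 < δ / M := by positivity
    filter_upwards [Metric.ball_mem_nhds 0 hδM] with v hv
    rw [mem_ball_zero_iff, lt_div_iff₀ (by positivity), mul_comm] at hv
    have hZv : ∀ s ∈ Set.Icc 0 T, ‖Z x s v‖ ≤ M * ‖v‖ := fun s hs ↦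
      (Z x s).le_of_opNorm_le (hZM x s hs) v
    have key := (hY (x + v)).dist_le hF hFK (v := fun s ↦ Y x s + Z x s v)
      (v' := fun s ↦ f (Y x s + w s) + A x s (Z x s) v) (δ := 0)
      (ε := c / (M * M) * (M * ‖v‖)) le_rfl (by positivity)
      ((hY x).continuousOn.add ((hZ x).continuousOn.clm_apply continuousOn_const))
      (fun s hs ↦ ((hY x).hasDerivWithinAt hF hs).add
        (by simpa using ((hZ x).hasDerivWithinAt (hA x) hs).clm_apply
              (hasDerivWithinAt_const s (Set.Ici s) v)))
      (fun s hs ↦ ?_) (by simp [(hY x).apply_zero hT, (hZ x).apply_zero hT]) ht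
    · rw [dist_comm, dist_eq_norm] at key
      calc _ = ‖Y (x + v) t - (Y x t + Z x t v)‖ := by rw [sub_sub]
        _ ≤ _ := key
        _ = c * ‖v‖ := by
          change (0 + c / (M * M) * (M * ‖v‖)) * M = _
          field_simp
          ring
    · have hs' := Set.Ico_subset_Icc_self hs
      have h1 := h (Y x s + w s) (Z x s v) ((hZv s hs').trans_lt hv)
      rw [dist_comm, dist_eq_norm]
      simp only [A, hycY x hs', ContinuousLinearMap.comp_apply]
      calc _ = ‖f (Y x s + w s + Z x s v) - f (Y x s + w s)
              - fderiv ℝ f (Y x s + w s) (Z x s v)‖ := by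
            rw [sub_sub, add_right_comm]
        _ ≤ _ := h1
        _ ≤ _ := by gcongr; exact hZv s hs'
  · refine continuousOn_uncurry_of_uniform (fun x ↦ (hY x).continuousOn) fun x ε hε ↦
      ⟨ε / M, by positivity, fun y hy t ht ↦ (hYd x y t ht).trans ?_⟩
    rw [lt_div_iff₀ (by positivity), mul_comm] at hy
    exact hy.le
  · refine continuousOn_uncurry_of_uniform (fun x ↦ (hZ x).continuousOn) fun x ε hε ↦ ?_
    obtain ⟨δ, hδ, h⟩ := Metric.uniformContinuous_iff.1 huc (ε / (M * M)) (by positivity)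
    refine ⟨δ / M, by positivity, fun y hy t ht ↦ ?_⟩
    rw [lt_div_iff₀ (by positivity), mul_comm] at hy
    refine ((hZ x).dist_le (hA x) (hAK x) (δ := 0) (ε := ε / (M * M) * M) le_rfl (by positivity)
      (hZ y).continuousOn (fun s hs ↦ (hZ y).hasDerivWithinAt (hA y) hs) (fun s hs ↦ ?_)
      (by rw [(hZ y).apply_zero hT, dist_self]) ht).trans_eq ?_
    · have hs' := Set.Ico_subset_Icc_self hs
      rw [dist_eq_norm]
      simp only [A, hycY _ hs']
      rw [← ContinuousLinearMap.sub_comp]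
      refine (ContinuousLinearMap.opNorm_comp_le _ _).trans ?_
      gcongr
      · rw [← dist_eq_norm]
        refine (h ?_).le
        rw [dist_add_right]
        exact (hYd x y s hs').trans_lt hy
      · exact hZM y s hs'
    · change (0 + ε / (M * M) * M) * M = _
      field_simp
      ring

end ODE

lemma IsNorm.exists_norm_le_mul {E : Type*} [NormedAddCommGroup E] [NormedSpace ℝ E]
    [FiniteDimensional ℝ E] {N : E → ℝ} (hN : IsNorm N) :
    ∃ C > 0, ∀ x, ‖x‖ ≤ C * N x := by
  obtain ⟨h0, hsmul, hadd⟩ := hN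
  have hcont : Continuous N := by
    refine continuousOn_univ.1 (ConvexOn.continuousOn isOpen_univ
      ⟨convex_univ, fun x _ y _ a b ha hb _ ↦ ?_⟩)
    simpa [hsmul, abs_of_nonneg, ha, hb] using hadd (a • x) (b • y)
  have hpos : ∀ x ≠ 0, 0 < N x := fun x hx ↦ by
    have h1 := hadd x ((-1 : ℝ) • x)
    rw [hsmul] at h1
    have h2 : N 0 = 0 := (h0 0).2 rfl
    have h3 : N x ≠ 0 := fun h ↦ hx ((h0 x).1 h)
    simp only [neg_smul, one_smul, add_neg_cancel, h2, abs_neg, abs_one, one_mul] at h1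
    exact lt_of_le_of_ne (by linarith) h3.symm
  have : ProperSpace E := FiniteDimensional.proper_real E
  obtain ⟨a, ha, h⟩ := (isCompact_sphere (0 : E) 1).exists_forall_le' hcont.continuousOn
    (a := 0) fun x hx ↦ hpos x fun h ↦ by simp [h] at hx
  refine ⟨a⁻¹, by positivity, fun x ↦ ?_⟩
  rcases eq_or_ne x 0 with rfl | hx
  · simp [(h0 0).2 rfl]
  have hx' : 0 < ‖x‖ := norm_pos_iff.2 hx
  have h1 := h (‖x‖⁻¹ • x) (by simp [norm_smul, hx'.ne'])
  rw [hsmul, abs_of_pos (by positivity), ← div_eq_inv_mul, le_div_iff₀ hx'] at h1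
  rwa [← div_eq_inv_mul, le_div_iff₀ ha, mul_comm]

namespace ODE

variable {E : Type*} [NormedAddCommGroup E] [NormedSpace ℝ E]

/-- A Lyapunov function grows at most exponentially along a curve. -/
lemma lyapunov_le {V : E → ℝ} (hV : ContDiff ℝ 1 V) {u u' : ℝ → E} {T c : ℝ}
    (hu : ContinuousOn u (Set.Icc 0 T))
    (hu' : ∀ t ∈ Set.Ico 0 T, HasDerivWithinAt u (u' t) (Set.Ici t) t)
    (h : ∀ t ∈ Set.Ico 0 T, fderiv ℝ V (u t) (u' t) ≤ c * V (u t)) {t : ℝ}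
    (ht : t ∈ Set.Icc 0 T) : V (u t) ≤ V (u 0) * Real.exp (c * t) := by
  have := le_gronwallBound_of_liminf_deriv_right_le (f := fun t ↦ V (u t))
    (f' := fun t ↦ fderiv ℝ V (u t) (u' t)) (δ := V (u 0)) (K := c) (ε := 0)
    (hV.continuous.comp_continuousOn hu)
    (fun s hs r hr ↦ ((hV.differentiable one_ne_zero (u s)).hasFDerivAt.comp_hasDerivWithinAt s
      (hu' s hs)).liminf_right_slope_le hr) le_rfl (by simpa using h) t ht
  simpa [gronwallBound_ε0] using this

/-- Solutions depend measurably on a measurable driving path. -/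
lemma measurable_of_isPicardSolution [CompleteSpace E] [SecondCountableTopology E]
    [MeasurableSpace E] [BorelSpace E] {Ω : Type*} [MeasurableSpace Ω] {f : E → E} {K : ℝ≥0}
    (hf : LipschitzWith K f) {w : ℝ → Ω → E} (hwc : ∀ ω, Continuous fun t ↦ w t ω)
    (hwm : ∀ t, Measurable (w t)) {T : ℝ} {x : E} {u : Ω → ℝ → E}
    (hu : ∀ ω, IsPicardSolution (fun t y ↦ f (y + w t ω)) T x (u ω)) {t : ℝ}
    (ht : t ∈ Set.Icc 0 T) : Measurable fun ω ↦ u ω t := by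
  have hF : ∀ ω, Continuous (Function.uncurry fun t y ↦ f (y + w t ω)) := fun ω ↦
    hf.continuous.uncurry_comp_add (hwc ω)
  have hq : ∀ n t, Measurable fun ω ↦
      (picard (fun t y ↦ f (y + w t ω)) 0 x)^[n] (fun _ ↦ x) t := by
    intro n
    induction n with
    | zero => exact fun _ ↦ measurable_const
    | succ n ih =>
      intro t
      simp only [Function.iterate_succ_apply', picard_apply]
      have hjoint := measurable_uncurry_of_continuous_of_measurable
        (u := fun s ω ↦ f ((picard (fun t y ↦ f (y + w t ω)) 0 x)^[n] (fun _ ↦ x) s + w s ω))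
        (fun ω ↦ hf.continuous.comp
          ((continuous_iterate_picard (hF ω) x continuous_const n).add (hwc ω)))
        (fun s ↦ hf.continuous.measurable.comp ((ih s).add (hwm s)))
      simp only [intervalIntegral]
      exact measurable_const.add
        ((hjoint.stronglyMeasurable.integral_prod_left).measurable.sub
          (hjoint.stronglyMeasurable.integral_prod_left).measurable)
  exact measurable_of_tendsto_metrizable (hq · t) (tendsto_pi_nhds.2 fun ω ↦
    (hu ω).tendsto_iterate_picard (hF ω) (fun s ↦ hf.comp_add_right (w s ω)) ht)

section Truncation

variable [FiniteDimensional ℝ E]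

/-- A smooth cutoff function which equals one on the closed ball of radius `n + 1`. -/
def cutoff (E : Type*) [NormedAddCommGroup E] [NormedSpace ℝ E] [FiniteDimensional ℝ E] (n : ℕ) :
    ContDiffBump (0 : E) where
  rIn := n + 1
  rOut := n + 2
  rIn_pos := by positivity
  rIn_lt_rOut := by linarith

/-- The vector field `f` multiplied with `cutoff E n`. -/
def truncate (f : E → E) (n : ℕ) (y : E) : E := cutoff E n y • f y

lemma contDiff_truncate {f : E → E} (hf : ContDiff ℝ 1 f) (n : ℕ) :
    ContDiff ℝ 1 (truncate f n) :=
  (cutoff E n).contDiff.smul hf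

lemma hasCompactSupport_truncate (f : E → E) (n : ℕ) : HasCompactSupport (truncate f n) :=
  (cutoff E n).hasCompactSupport.smul_right

lemma truncate_eq (f : E → E) {n : ℕ} {y : E} (hy : ‖y‖ ≤ n + 1) : truncate f n y = f y := by
  rw [truncate, (cutoff E n).one_of_mem_closedBall (mem_closedBall_zero_iff.2 hy), one_smul]

lemma fderiv_truncate_eq (f : E → E) {n : ℕ} {y : E} (hy : ‖y‖ < n + 1) :
    fderiv ℝ (truncate f n) y = fderiv ℝ f y := by
  refine Filter.EventuallyEq.fderiv_eq ?_
  filter_upwards [Metric.isOpen_ball.mem_nhds (mem_ball_zero_iff.2 hy)] with z hz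
  exact truncate_eq f (mem_ball_zero_iff.1 hz).le

lemma exists_lipschitzWith_truncate {f : E → E} (hf : ContDiff ℝ 1 f) (n : ℕ) :
    ∃ K, LipschitzWith K (truncate f n) :=
  (contDiff_truncate hf n).lipschitzWith_of_hasCompactSupport (hasCompactSupport_truncate f n)
    one_ne_zero

lemma isPicardSolution_truncate_iff {f : E → E} {w : ℝ → E} {T : ℝ} {x : E} {u : ℝ → E} {n : ℕ}
    (h : ∀ t ∈ Set.Icc 0 T, ‖u t + w t‖ ≤ n + 1) :
    IsPicardSolution (fun t y ↦ truncate f n (y + w t)) T x u ↔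
      IsPicardSolution (fun t y ↦ f (y + w t)) T x u := by
  have : ∀ t ∈ Set.Icc 0 T, picard (fun t y ↦ truncate f n (y + w t)) 0 x u t =
      picard (fun t y ↦ f (y + w t)) 0 x u t := by
    intro t ht
    simp only [picard_apply]
    congr 1
    refine intervalIntegral.integral_congr fun s hs ↦ ?_
    rw [Set.uIcc_of_le ht.1] at hs
    exact truncate_eq f (h s ⟨hs.1, hs.2.trans ht.2⟩)
  exact ⟨fun hu ↦ ⟨hu.1, fun t ht ↦ (hu.2 t ht).trans (this t ht)⟩,
    fun hu ↦ ⟨hu.1, fun t ht ↦ (hu.2 t ht).trans (this t ht).symm⟩⟩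

lemma IsPicardSolution.eqOn_of_truncate {f : E → E} (hf : ContDiff ℝ 1 f) {w : ℝ → E}
    (hw : Continuous w) {T : ℝ} {x : E} {n : ℕ} {u v : ℝ → E}
    (hu : IsPicardSolution (fun t y ↦ truncate f n (y + w t)) T x u)
    (hv : IsPicardSolution (fun t y ↦ truncate f n (y + w t)) T x v) :
    Set.EqOn u v (Set.Icc 0 T) := by
  have : CompleteSpace E := FiniteDimensional.complete ℝ E
  obtain ⟨K, hK⟩ := exists_lipschitzWith_truncate hf n
  intro t ht
  have := hv.dist_le_of_isPicardSolution
    ((contDiff_truncate hf n).continuous.uncurry_comp_add hw) (fun s ↦ hK.comp_add_right (w s)) hu ht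
  rw [dist_self, mul_zero] at this
  exact dist_le_zero.1 this

/-- Solutions for a `C¹` field with an additive perturbation are unique. -/
lemma IsPicardSolution.eqOn {f : E → E} (hf : ContDiff ℝ 1 f) {w : ℝ → E}
    (hw : Continuous w) {T : ℝ} {x : E} {u v : ℝ → E}
    (hu : IsPicardSolution (fun t y ↦ f (y + w t)) T x u)
    (hv : IsPicardSolution (fun t y ↦ f (y + w t)) T x v) :
    Set.EqOn u v (Set.Icc 0 T) := by
  obtain ⟨B, hB⟩ := (isCompact_Icc (a := 0) (b := T)).exists_bound_of_continuousOn
    (hu.continuousOn.add hw.continuousOn)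
  obtain ⟨C, hC⟩ := (isCompact_Icc (a := 0) (b := T)).exists_bound_of_continuousOn
    (hv.continuousOn.add hw.continuousOn)
  obtain ⟨n, hn⟩ := exists_nat_ge (max B C)
  refine IsPicardSolution.eqOn_of_truncate hf hw (n := n)
    ((isPicardSolution_truncate_iff fun t ht ↦ (hB t ht).trans ?_).2 hu)
    ((isPicardSolution_truncate_iff fun t ht ↦ (hC t ht).trans ?_).2 hv)
  · linarith [le_max_left B C]
  · linarith [le_max_right B C]

lemma exists_isPicardSolution_truncate {f : E → E} (hf : ContDiff ℝ 1 f) {w : ℝ → E}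
    (hw : Continuous w) {T : ℝ} (hT : 0 ≤ T) (n : ℕ) (x : E) :
    ∃ u, IsPicardSolution (fun t y ↦ truncate f n (y + w t)) T x u := by
  have : CompleteSpace E := FiniteDimensional.complete ℝ E
  obtain ⟨K, hK⟩ := exists_lipschitzWith_truncate hf n
  exact exists_isPicardSolution ((contDiff_truncate hf n).continuous.uncurry_comp_add hw)
    (fun s ↦ hK.comp_add_right (w s)) hT x

/-- Solutions of the truncated equations are bounded on bounded sets of initial values,
uniformly in the truncation. -/
def HasUniformBound (f : E → E) (w : ℝ → E) (T : ℝ) : Prop :=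
  ∀ R : ℝ, ∃ B : ℝ, ∀ n x u, ‖x‖ ≤ R →
    IsPicardSolution (fun t y ↦ truncate f n (y + w t)) T x u →
    ∀ t ∈ Set.Icc 0 T, ‖u t + w t‖ ≤ B

lemma HasUniformBound.exists_forall_isPicardSolution {f : E → E} {w : ℝ → E} {T : ℝ}
    (h : HasUniformBound f w T) (R : ℝ) :
    ∃ N : ℕ, ∀ n ≥ N, ∀ x u, ‖x‖ ≤ R →
      IsPicardSolution (fun t y ↦ truncate f n (y + w t)) T x u →
      IsPicardSolution (fun t y ↦ f (y + w t)) T x u ∧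
        ∀ t ∈ Set.Icc 0 T, ‖u t + w t‖ < n + 1 := by
  obtain ⟨B, hB⟩ := h R
  obtain ⟨N, hN⟩ := exists_nat_ge B
  refine ⟨N, fun n hn x u hx hu ↦ ?_⟩
  have hn' : (N : ℝ) ≤ n := by exact_mod_cast hn
  have hlt : ∀ t ∈ Set.Icc 0 T, ‖u t + w t‖ < n + 1 := fun t ht ↦ by
    linarith [hB n x u hx hu t ht]
  exact ⟨(isPicardSolution_truncate_iff fun t ht ↦ (hlt t ht).le).1 hu, hlt⟩

/-- A coercive Lyapunov function provides a uniform bound for the truncated equations. -/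
lemma hasUniformBound_of_lyapunov {f : E → E} (hf : ContDiff ℝ 1 f) {w : ℝ → E}
    (hw : Continuous w) {T c C : ℝ} (hT : 0 ≤ T) (hc : 0 ≤ c) (hC : 0 ≤ C) {V : E → ℝ}
    (hV : ContDiff ℝ 1 V) (hV0 : ∀ x, 0 ≤ V x) (hVC : ∀ x, ‖x‖ ≤ C * V x)
    (hL : ∀ t ∈ Set.Icc 0 T, ∀ x, fderiv ℝ V x (f (x + w t)) ≤ c * V x) :
    HasUniformBound f w T := by
  have : CompleteSpace E := FiniteDimensional.complete ℝ E
  have : ProperSpace E := FiniteDimensional.proper_real E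
  intro R
  obtain ⟨A, hA⟩ := (isCompact_closedBall (0 : E) R).exists_bound_of_continuousOn
    hV.continuous.continuousOn
  obtain ⟨D, hD⟩ := (isCompact_Icc (a := 0) (b := T)).exists_bound_of_continuousOn
    hw.continuousOn
  refine ⟨C * (A * Real.exp (c * T)) + D, fun n x u hx hu t ht ↦ ?_⟩
  have hF : Continuous (Function.uncurry fun t y ↦ truncate f n (y + w t)) :=
    (contDiff_truncate hf n).continuous.uncurry_comp_add hw
  have h1 := lyapunov_le hV (c := c) hu.continuousOn (fun s hs ↦ hu.hasDerivWithinAt hF hs)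
    (fun s hs ↦ ?_) ht
  · have hVx : V x ≤ A := (le_abs_self _).trans (hA x (mem_closedBall_zero_iff.2 hx))
    rw [hu.apply_zero hT] at h1
    have h2 : V (u t) ≤ A * Real.exp (c * T) := h1.trans (by
      have := (hV0 x).trans hVx
      gcongr
      exact ht.2)
    exact (norm_add_le _ _).trans (add_le_add ((hVC _).trans (by gcongr)) (hD t ht))
  · simp only [truncate, map_smul, smul_eq_mul]
    have h0 := (cutoff E n).nonneg (x := u s + w s)
    have h1 := (cutoff E n).le_one (x := u s + w s)
    have h2 := hL s (Set.Ico_subset_Icc_self hs) (u s)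
    have h3 := mul_nonneg hc (hV0 (u s))
    nlinarith

/-- Under a uniform bound for the truncated equations, the solution `Y x + w` of the equation
with an additive perturbation `w` is `C¹` in the initial value and its derivative solves the
variational equation. -/
theorem HasUniformBound.differentiable_flow {f : E → E} (hf : ContDiff ℝ 1 f) {w : ℝ → E}
    (hw : Continuous w) {T : ℝ} (hT : 0 ≤ T) (h : HasUniformBound f w T) {Y : E → ℝ → E}
    (hY : ∀ x, IsPicardSolution (fun t y ↦ f (y + w t)) T x (Y x)) :
    ContinuousOn (fun p : ℝ × E ↦ Y p.2 p.1 + w p.1) (Set.Icc 0 T ×ˢ Set.univ) ∧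
    (∀ t ∈ Set.Icc 0 T, Differentiable ℝ fun x ↦ Y x t + w t) ∧
    ContinuousOn (fun p : ℝ × E ↦ fderiv ℝ (fun x ↦ Y x p.1 + w p.1) p.2)
      (Set.Icc 0 T ×ˢ Set.univ) ∧
    ∀ x v, ∀ t ∈ Set.Icc 0 T, fderiv ℝ (fun y ↦ Y y t + w t) x v =
      v + ∫ s in (0 : ℝ)..t,
        fderiv ℝ f (Y x s + w s) (fderiv ℝ (fun y ↦ Y y s + w s) x v) := by
  have : CompleteSpace E := FiniteDimensional.complete ℝ E
  have key : ∀ x₀ : E, ∃ Z : E → ℝ → E →L[ℝ] E, ∃ U : E → ℝ → E, ∃ s ∈ 𝓝 x₀,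
      (∀ x ∈ s, ∀ t ∈ Set.Icc 0 T, Y x t = U x t ∧
        HasFDerivAt (fun y ↦ Y y t + w t) (Z x t) x) ∧
      (∀ x ∈ s, ∀ t ∈ Set.Icc 0 T, Z x t = ContinuousLinearMap.id ℝ E +
        ∫ s in (0 : ℝ)..t, (fderiv ℝ f (Y x s + w s)).comp (Z x s)) ∧
      ContinuousOn (fun p : ℝ × E ↦ U p.2 p.1) (Set.Icc 0 T ×ˢ Set.univ) ∧
      ContinuousOn (fun p : ℝ × E ↦ Z p.2 p.1) (Set.Icc 0 T ×ˢ Set.univ) := by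
    intro x₀
    obtain ⟨N, hN⟩ := h.exists_forall_isPicardSolution (‖x₀‖ + 1)
    choose U hU using exists_isPicardSolution_truncate hf hw hT N
    obtain ⟨Z, -, hZ, hUZ, hUc, hZc⟩ := exists_flow_of_hasCompactSupport (contDiff_truncate hf N)
      (hasCompactSupport_truncate f N) hw hT hU
    have hs : ∀ x ∈ Metric.ball x₀ 1, ‖x‖ ≤ ‖x₀‖ + 1 := fun x hx ↦ by
      rw [mem_ball_iff_norm] at hx
      linarith [norm_le_norm_add_norm_sub' x x₀]
    have hUY : ∀ x ∈ Metric.ball x₀ 1, Set.EqOn (Y x) (U x) (Set.Icc 0 T) := fun x hx ↦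
      (hY x).eqOn hf hw (hN N le_rfl x (U x) (hs x hx) (hU x)).1
    refine ⟨Z, U, Metric.ball x₀ 1, Metric.ball_mem_nhds _ one_pos,
      fun x hx t ht ↦ ⟨hUY x hx ht, ?_⟩, fun x hx t ht ↦ ?_, hUc, hZc⟩
    · refine ((hUZ x t ht).add_const (w t)).congr_of_eventuallyEq ?_
      filter_upwards [Metric.isOpen_ball.mem_nhds hx] with y hy
      rw [hUY y hy ht]
    · rw [hZ x t ht]
      congr 1
      refine intervalIntegral.integral_congr fun s hs' ↦ ?_
      rw [Set.uIcc_of_le ht.1] at hs'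
      have hs'' : s ∈ Set.Icc 0 T := ⟨hs'.1, hs'.2.trans ht.2⟩
      simp only [hUY x hx hs'']
      rw [fderiv_truncate_eq f ((hN N le_rfl x (U x) (hs x hx) (hU x)).2 s hs'')]
  have hnhds : ∀ {x₀ : E} {t : ℝ} {s : Set E}, s ∈ 𝓝 x₀ →
      ∀ᶠ p in 𝓝[Set.Icc 0 T ×ˢ Set.univ] (t, x₀), p.1 ∈ Set.Icc 0 T ∧ p.2 ∈ s := by
    intro x₀ t s hs
    rw [nhdsWithin_prod_eq, nhdsWithin_univ]
    exact eventually_mem_nhdsWithin.prod_mk hs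
  refine ⟨?_, fun t ht x ↦ ?_, ?_, fun x v t ht ↦ ?_⟩
  · rintro ⟨t, x⟩ htx
    obtain ⟨Z, U, s, hs, hYU, -, hUc, -⟩ := key x
    refine ((hUc _ htx).add (hw.comp continuous_fst).continuousWithinAt).congr_of_eventuallyEq
      ?_ (by simp [(hYU x (mem_of_mem_nhds hs) t htx.1).1])
    filter_upwards [hnhds hs] with p hp
    simp [(hYU p.2 hp.2 p.1 hp.1).1]
  · obtain ⟨Z, U, s, hs, hYU, -⟩ := key x
    exact (hYU x (mem_of_mem_nhds hs) t ht).2.differentiableAt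
  · rintro ⟨t, x⟩ htx
    obtain ⟨Z, U, s, hs, hYU, -, -, hZc⟩ := key x
    refine (hZc _ htx).congr_of_eventuallyEq ?_
      (hYU x (mem_of_mem_nhds hs) t htx.1).2.fderiv
    filter_upwards [hnhds hs] with p hp
    exact (hYU p.2 hp.2 p.1 hp.1).2.fderiv
  · obtain ⟨Z, U, s, hs, hYU, hZ, -, hZc⟩ := key x
    have hx := mem_of_mem_nhds hs
    have hZx : ContinuousOn (Z x) (Set.Icc 0 T) :=
      hZc.comp (f := fun s ↦ (s, x)) (by fun_prop) fun s hs ↦ ⟨hs, trivial⟩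
    have hFi : IntervalIntegrable (fun s ↦ (fderiv ℝ f (Y x s + w s)).comp (Z x s))
        volume 0 t := by
      refine ContinuousOn.intervalIntegrable ?_
      rw [Set.uIcc_of_le ht.1]
      exact (((hf.continuous_fderiv one_ne_zero).comp_continuousOn
        ((hY x).continuousOn.add hw.continuousOn)).clm_comp hZx).mono
        (Set.Icc_subset_Icc_right ht.2)
    rw [(hYU x hx t ht).2.fderiv, hZ x hx t ht, _root_.add_apply,
      ContinuousLinearMap.id_apply, ContinuousLinearMap.intervalIntegral_apply hFi]
    congr 1
    refine intervalIntegral.integral_congr fun r hr ↦ ?_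
    rw [Set.uIcc_of_le ht.1] at hr
    simp only [(hYU x hx r ⟨hr.1, hr.2.trans ht.2⟩).2.fderiv, ContinuousLinearMap.comp_apply]

end Truncation

end ODE

/-- **Lemma (existence, uniqueness and differentiability in the initial value
for additive noise SDEs).** -/
theorem sde_existence_uniqueness_differentiability
    (d m : ℕ) (hd : 0 < d) (hm : 0 < m) (T : ℝ) (hT : 0 ≤ T)
    (μ : (Fin d → ℝ) → (Fin d → ℝ)) (hμ : ContDiff ℝ 1 μ)
    (σ : Matrix (Fin d) (Fin m) ℝ)
    (φ : (Fin m → ℝ) → ℝ) (hφc : Continuous φ) (hφ0 : ∀ z, 0 ≤ φ z)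
    (V : (Fin d → ℝ) → ℝ) (hV : ContDiff ℝ 1 V) (hV0 : ∀ x, 0 ≤ V x)
    (Nd : (Fin d → ℝ) → ℝ) (hNd : IsNorm Nd)
    (hLyap : ∀ (x : Fin d → ℝ) (z : Fin m → ℝ),
      fderiv ℝ V x (μ (x + σ.mulVec z)) ≤ φ z * V x)
    (hNV : ∀ x, Nd x ≤ V x)
    {Ω : Type*} [MeasurableSpace Ω] (P : Measure Ω) [IsProbabilityMeasure P]
    (W : ℝ → Ω → (Fin m → ℝ))
    (hWmeas : ∀ t ∈ Set.Icc (0 : ℝ) T, Measurable (W t))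
    (hWcont : ∀ ω, ContinuousOn (fun t => W t ω) (Set.Icc (0 : ℝ) T)) :
    ∃ X : (Fin d → ℝ) → ℝ → Ω → (Fin d → ℝ),
      (IsSolution d m T μ σ W X ∧
        ∀ Y : (Fin d → ℝ) → ℝ → Ω → (Fin d → ℝ), IsSolution d m T μ σ W Y →
          ∀ x : Fin d → ℝ, ∀ t ∈ Set.Icc (0 : ℝ) T, ∀ ω, Y x t ω = X x t ω) ∧
      (∀ ω, IsC01 d T (fun t x => X x t ω)) ∧
      (∀ x h : Fin d → ℝ, ∀ t ∈ Set.Icc (0 : ℝ) T, ∀ ω,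
        fderiv ℝ (fun y => X y t ω) x h =
          h + ∫ s in (0 : ℝ)..t,
            fderiv ℝ μ (X x s ω) (fderiv ℝ (fun y => X y s ω) x h)) := by
  have hσ : Continuous fun z : Fin m → ℝ => σ.mulVec z :=
    continuous_const.matrix_mulVec continuous_id
  let p : ℝ → ℝ := fun t => Set.projIcc 0 T hT t
  have hp : ∀ t, p t ∈ Set.Icc 0 T := fun t => (Set.projIcc 0 T hT t).2
  have hpc : Continuous p := continuous_subtype_val.comp continuous_projIcc
  have hpt : ∀ t ∈ Set.Icc 0 T, p t = t := fun t ht => by simp [p, Set.projIcc_of_mem hT ht]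
  let w : ℝ → Ω → (Fin d → ℝ) := fun t ω => σ.mulVec (W (p t) ω)
  have hwc : ∀ ω, Continuous fun t => w t ω := fun ω =>
    hσ.comp ((hWcont ω).comp_continuous hpc hp)
  have hwm : ∀ t, Measurable (w t) := fun t => hσ.measurable.comp (hWmeas _ (hp t))
  have hb : ∀ ω, ODE.HasUniformBound μ (fun t => w t ω) T := by
    intro ω
    obtain ⟨C, hC, hNC⟩ := hNd.exists_norm_le_mul
    obtain ⟨c, hc⟩ := (isCompact_Icc (a := 0) (b := T)).exists_bound_of_continuousOn
      (hφc.comp_continuousOn (hWcont ω))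
    have hc0 : 0 ≤ c := (norm_nonneg _).trans (hc 0 ⟨le_rfl, hT⟩)
    refine ODE.hasUniformBound_of_lyapunov hμ (hwc ω) hT hc0 hC.le hV hV0
      (fun x => (hNC x).trans (by gcongr; exact hNV x)) fun t ht x => ?_
    simp only [w, hpt t ht]
    exact (hLyap x _).trans
      (mul_le_mul_of_nonneg_right ((le_abs_self _).trans (hc t ht)) (hV0 x))
  choose U hU using fun n ω x => ODE.exists_isPicardSolution_truncate hμ (hwc ω) hT n x
  have hYex : ∀ ω x, ∃ u, ODE.IsPicardSolution (fun t y => μ (y + w t ω)) T x u := by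
    intro ω x
    obtain ⟨N, hN⟩ := (hb ω).exists_forall_isPicardSolution ‖x‖
    exact ⟨U N ω x, (hN N le_rfl x _ le_rfl (hU N ω x)).1⟩
  choose Y hY using hYex
  have hYm : ∀ x, ∀ t ∈ Set.Icc 0 T, Measurable fun ω => Y ω x t := by
    intro x t ht
    refine measurable_of_tendsto_metrizable (f := fun n ω => U n ω x t) (fun n => ?_)
      (tendsto_pi_nhds.2 fun ω => ?_)
    · obtain ⟨K, hK⟩ := ODE.exists_lipschitzWith_truncate hμ n
      exact ODE.measurable_of_isPicardSolution hK hwc hwm (hU n · x) ht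
    · obtain ⟨N, hN⟩ := (hb ω).exists_forall_isPicardSolution ‖x‖
      refine tendsto_const_nhds.congr' ?_
      filter_upwards [eventually_ge_atTop N] with n hn
      exact (hY ω x).eqOn hμ (hwc ω) (hN n hn x _ le_rfl (hU n ω x)).1 ht
  have hflow := fun ω => (hb ω).differentiable_flow hμ (hwc ω) hT (hY ω)
  refine ⟨fun x t ω => Y ω x t + w t ω, ⟨fun x => ⟨fun t ht => (hYm x t ht).add (hwm t),
    fun ω => (hY ω x).continuousOn.add (hwc ω).continuousOn, fun t ht ω => ?_⟩,
    fun X hX x t ht ω => ?_⟩, fun ω => ⟨(hflow ω).1, (hflow ω).2.1, (hflow ω).2.2.1⟩,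
    fun x h t ht ω => (hflow ω).2.2.2 x h t ht⟩
  · change Y ω x t + w t ω = _
    rw [(hY ω x).eq_picard t ht, ODE.picard_apply]
    simp only [w, hpt t ht]
  · obtain ⟨-, hXc, hXe⟩ := hX x
    have hXs : ODE.IsPicardSolution (fun t y => μ (y + w t ω)) T x
        (fun t => X x t ω - w t ω) := by
      refine ⟨(hXc ω).sub (hwc ω).continuousOn, fun s hs => ?_⟩
      simp only [ODE.picard_apply, sub_add_cancel]
      rw [hXe s hs ω]
      simp only [w, hpt s hs, add_sub_cancel_right]
    exact sub_eq_iff_eq_add.1 (hXs.eqOn hμ (hwc ω) (hY ω x) ht)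
end
end
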